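/- arXiv:2510.09562 — 2 statements merged into one kernel-verified Lean document; each statement's English description precedes it below -/
import Mathlib

section
/- On a probability space, let X₁, X₂, … be nonnegative random variables with common survival function P(Xᵢ > x) = x^{-α} l(x) for all x > 0, where α ∈ (0,1) and l is slowly varying at infinity. Fix δ' > 2(1/α − 1) and set b_n := d_{n,1}/c_n^{2δ'} and b̃_n := d_{n,1}·c_n. Let h > 1 and suppose that Condition A(1) and Condition A(h) hold and that ∑_{1≤i,j≤n, i≠j} Cov(1(Xᵢ > b̃_n), 1(Xⱼ > b̃_n)) = o( n^{2α}·( l(b̃_n)/(l(t_n)·c_n) )² ). Define ι₊(h) := (h − α²)/(1 − α) and L_n := log c_n + |log l(t_n)| + |log l(b_n)| + |log l(b̃_n)|. Then log M^{+*}_{n,h}/log M_{n,1} − ι₊(h) = O_p(L_n/log n) as n → ∞. -/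
open MeasureTheory Filter

noncomputable section

/-- `l` is slowly varying at infinity: for every `lam > 0`, `l(lam*x)/l(x) → 1` as `x → ∞`. -/
def SlowlyVarying (l : ℝ → ℝ) : Prop :=
  ∀ lam : ℝ, 0 < lam → Tendsto (fun x => l (lam * x) / l x) atTop (nhds 1)

/-- Covariance `Cov(U,V) = E[UV] - E[U]E[V]`. -/
def cov {Ω : Type*} [MeasurableSpace Ω] (μ : Measure Ω) (U V : Ω → ℝ) : ℝ :=
  (∫ ω, U ω * V ω ∂μ) - (∫ ω, U ω ∂μ) * (∫ ω, V ω ∂μ)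

/-- Truncation `X·1(X < t)`. -/
def trunc {Ω : Type*} (X : Ω → ℝ) (t : ℝ) : Ω → ℝ :=
  fun ω => if X ω < t then X ω else 0

/-- Sum of covariances of `p`-th powers of the variables truncated at `v n`,
over distinct pairs of indices among the first `n`. -/
def covSum {Ω : Type*} [MeasurableSpace Ω] (μ : Measure Ω) (X : ℕ → Ω → ℝ)
    (v : ℕ → ℝ) (p : ℝ) (n : ℕ) : ℝ :=
  ∑ i ∈ Finset.range n, ∑ j ∈ Finset.range n,
    if i = j then 0
    else cov μ (fun ω => trunc (X i) (v n) ω ^ p) (fun ω => trunc (X j) (v n) ω ^ p)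

/-- Condition A(p). -/
def ConditionA {Ω : Type*} [MeasurableSpace Ω] (μ : Measure Ω) (X : ℕ → Ω → ℝ)
    (v c : ℕ → ℝ) (p : ℝ) : Prop :=
  Tendsto (fun n => covSum μ X v p n / (v n ^ (2 * p) * c n ^ 2)) atTop (nhds 0)

/-- `p`-th sample moment `M_{n,p}`. -/
def sampleMoment {Ω : Type*} (X : ℕ → Ω → ℝ) (p : ℝ) (n : ℕ) (ω : Ω) : ℝ :=
  (n : ℝ)⁻¹ * ∑ i ∈ Finset.range n, X i ω ^ p

/-- `Y_n = O_p(r_n)`. -/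
def IsOp {Ω : Type*} [MeasurableSpace Ω] (μ : Measure Ω) (Y : ℕ → Ω → ℝ) (r : ℕ → ℝ) : Prop :=
  ∀ ε : ℝ, 0 < ε → ∃ C : ℝ, 0 < C ∧
    ∀ᶠ n in atTop, (μ {ω | C * r n < |Y n ω|}).toReal < ε

/-- Convergence in probability to a constant. -/
def TendstoInProbability {Ω : Type*} [MeasurableSpace Ω] (μ : Measure Ω)
    (Y : ℕ → Ω → ℝ) (a : ℝ) : Prop :=
  ∀ ε : ℝ, 0 < ε → Tendsto (fun n => (μ {ω | ε < |Y n ω - a|}).toReal) atTop (nhds 0)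

/-- Number of sample points exceeding the sample mean, `N⁺_n` (as a real number). -/
def Nplus {Ω : Type*} (X : ℕ → Ω → ℝ) (n : ℕ) (ω : Ω) : ℝ :=
  ∑ i ∈ Finset.range n, if sampleMoment X 1 n ω < X i ω then (1 : ℝ) else 0

/-- `h`-th sample central local upper moment `M^{+*}_{n,h}`. -/
def localUpperMoment {Ω : Type*} (X : ℕ → Ω → ℝ) (h : ℝ) (n : ℕ) (ω : Ω) : ℝ :=
  (Nplus X n ω)⁻¹ * ∑ i ∈ Finset.range n, max (X i ω - sampleMoment X 1 n ω) 0 ^ h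

/-- Truncated first moment `d_{n,1} = E[X₁ · 1(X₁ < t_n)]`. -/
def dOne {Ω : Type*} [MeasurableSpace Ω] (μ : Measure Ω) (X : ℕ → Ω → ℝ)
    (t : ℕ → ℝ) (n : ℕ) : ℝ :=
  ∫ ω, trunc (X 0) (t n) ω ∂μ

lemma rv_upper {S : ℝ → ℝ} (hanti : ∀ x y, 0 < x → x ≤ y → S y ≤ S x)
    (hpos : ∀ x, 0 < x → 0 < S x) {x0 q : ℝ} (hx0 : 0 < x0) (hq : 0 < q)
    (hd : ∀ x, x0 ≤ x → S (2 * x) ≤ 2 ^ (-q) * S x) :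
    ∀ x y, x0 ≤ x → x ≤ y → (y / x) ^ q * S y ≤ 2 ^ q * S x := by
  intro x y hx hxy
  have hxp : 0 < x := lt_of_lt_of_le hx0 hx
  have hk : ∀ k : ℕ, ((2:ℝ) ^ k) ^ q * S (2 ^ k * x) ≤ S x := by
    intro k
    induction k with
    | zero => simp
    | succ k ih =>
      have h1 : x0 ≤ 2 ^ k * x := by
        have : (1:ℝ) ≤ 2 ^ k := one_le_pow₀ (by norm_num)
        nlinarith
      have h2 := hd _ h1
      have h3 : ((2:ℝ) ^ (k+1)) ^ q = (2 ^ k) ^ q * 2 ^ q := by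
        rw [pow_succ, Real.mul_rpow (by positivity) (by norm_num)]
      have h4 : (2:ℝ) ^ q * 2 ^ (-q) = 1 := by
        rw [← Real.rpow_add (by norm_num)]; simp
      have h5 : (2:ℝ) ^ (k+1) * x = 2 * (2 ^ k * x) := by ring
      rw [h3, h5]
      calc ((2:ℝ) ^ k) ^ q * 2 ^ q * S (2 * (2 ^ k * x))
          ≤ ((2:ℝ) ^ k) ^ q * 2 ^ q * (2 ^ (-q) * S (2 ^ k * x)) := by gcongr
        _ = ((2:ℝ) ^ k) ^ q * (2 ^ q * 2 ^ (-q)) * S (2 ^ k * x) := by ring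
        _ ≤ S x := by rw [h4, mul_one]; exact ih
  obtain ⟨k, hk1, hk2⟩ := exists_nat_pow_near (x := y / x) (y := 2)
    ((one_le_div hxp).2 hxy) (by norm_num)
  have h1 : 2 ^ k * x ≤ y := (le_div_iff₀ hxp).1 hk1
  have hyp : 0 < y := by linarith
  have h2 : (y / x) ^ q ≤ 2 ^ q * (2 ^ k) ^ q := by
    rw [← Real.mul_rpow (by norm_num) (by positivity)]
    apply Real.rpow_le_rpow (by positivity) _ hq.le
    rw [pow_succ] at hk2; linarith
  have h3 := hanti (2 ^ k * x) y (by positivity) h1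
  have hSy := (hpos y (by linarith)).le
  calc (y / x) ^ q * S y ≤ (2 ^ q * (2 ^ k) ^ q) * S (2 ^ k * x) := by gcongr
    _ = 2 ^ q * ((2 ^ k) ^ q * S (2 ^ k * x)) := by ring
    _ ≤ 2 ^ q * S x := by gcongr; exact hk k

lemma rv_lower {S : ℝ → ℝ} (hanti : ∀ x y, 0 < x → x ≤ y → S y ≤ S x)
    (hpos : ∀ x, 0 < x → 0 < S x) {x0 q : ℝ} (hx0 : 0 < x0) (hq : 0 < q)
    (hd : ∀ x, x0 ≤ x → 2 ^ (-q) * S x ≤ S (2 * x)) :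
    ∀ x y, x0 ≤ x → x ≤ y → S x ≤ 2 ^ q * ((y / x) ^ q * S y) := by
  intro x y hx hxy
  have hxp : 0 < x := lt_of_lt_of_le hx0 hx
  have hk : ∀ k : ℕ, S x ≤ ((2:ℝ) ^ k) ^ q * S (2 ^ k * x) := by
    intro k
    induction k with
    | zero => simp
    | succ k ih =>
      have h1 : x0 ≤ 2 ^ k * x := by
        have : (1:ℝ) ≤ 2 ^ k := one_le_pow₀ (by norm_num)
        nlinarith
      have h2 := hd _ h1
      have h3 : ((2:ℝ) ^ (k+1)) ^ q = (2 ^ k) ^ q * 2 ^ q := by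
        rw [pow_succ, Real.mul_rpow (by positivity) (by norm_num)]
      have h4 : (2:ℝ) ^ q * 2 ^ (-q) = 1 := by
        rw [← Real.rpow_add (by norm_num)]; simp
      have h5 : (2:ℝ) ^ (k+1) * x = 2 * (2 ^ k * x) := by ring
      rw [h3, h5]
      calc S x ≤ ((2:ℝ) ^ k) ^ q * (2 ^ q * 2 ^ (-q)) * S (2 ^ k * x) := by
            rw [h4, mul_one]; exact ih
        _ = ((2:ℝ) ^ k) ^ q * 2 ^ q * (2 ^ (-q) * S (2 ^ k * x)) := by ring
        _ ≤ _ := by gcongr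
  obtain ⟨k, hk1, hk2⟩ := exists_nat_pow_near (x := y / x) (y := 2)
    ((one_le_div hxp).2 hxy) (by norm_num)
  have h1 : y ≤ 2 ^ (k+1) * x := ((div_lt_iff₀ hxp).1 hk2).le
  have hyp : 0 < y := by linarith
  have h2 : ((2:ℝ) ^ (k+1)) ^ q ≤ 2 ^ q * (y / x) ^ q := by
    rw [← Real.mul_rpow (by norm_num) (by positivity)]
    apply Real.rpow_le_rpow (by positivity) _ hq.le
    rw [pow_succ]; linarith
  have h3 := hanti y _ hyp h1
  have hSy := (hpos y (by linarith)).le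
  calc S x ≤ ((2:ℝ) ^ (k+1)) ^ q * S (2 ^ (k+1) * x) := hk _
    _ ≤ (2 ^ q * (y / x) ^ q) * S y := by
        gcongr
        exact (hpos _ (by positivity)).le
    _ = _ := by ring

/-- The survival function properties used. -/
structure RV (S : ℝ → ℝ) (α : ℝ) : Prop where
  anti : ∀ x y, 0 < x → x ≤ y → S y ≤ S x
  pos : ∀ x, 0 < x → 0 < S x
  lim : Tendsto (fun x => S (2 * x) / S x) atTop (nhds (2 ^ (-α)))

lemma RV.dbl_upper {S : ℝ → ℝ} {α q : ℝ} (H : RV S α) (hq : q < α) :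
    ∃ x0, 0 < x0 ∧ ∀ x, x0 ≤ x → S (2 * x) ≤ 2 ^ (-q) * S x := by
  have h1 : (2:ℝ) ^ (-α) < 2 ^ (-q) := Real.rpow_lt_rpow_of_exponent_lt (by norm_num) (by linarith)
  obtain ⟨a, ha⟩ := eventually_atTop.1 (H.lim.eventually (gt_mem_nhds h1))
  refine ⟨max a 1, by positivity, fun x hx => ?_⟩
  have h2 := ha x (le_trans (le_max_left _ _) hx)
  have hxp : 0 < x := lt_of_lt_of_le (by norm_num) (le_trans (le_max_right a 1) hx)
  exact ((div_lt_iff₀ (H.pos x hxp)).1 h2).le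

lemma RV.dbl_lower {S : ℝ → ℝ} {α q : ℝ} (H : RV S α) (hq : α < q) :
    ∃ x0, 0 < x0 ∧ ∀ x, x0 ≤ x → 2 ^ (-q) * S x ≤ S (2 * x) := by
  have h1 : (2:ℝ) ^ (-q) < 2 ^ (-α) := Real.rpow_lt_rpow_of_exponent_lt (by norm_num) (by linarith)
  obtain ⟨a, ha⟩ := eventually_atTop.1 (H.lim.eventually (lt_mem_nhds h1))
  refine ⟨max a 1, by positivity, fun x hx => ?_⟩
  have h2 := ha x (le_trans (le_max_left _ _) hx)
  have hxp : 0 < x := lt_of_lt_of_le (by norm_num) (le_trans (le_max_right a 1) hx)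
  exact ((lt_div_iff₀ (H.pos x hxp)).1 h2).le

lemma tail_diff {Ω : Type*} [MeasurableSpace Ω] (μ : Measure Ω) [IsProbabilityMeasure μ]
    {S : ℝ → ℝ} {Y : Ω → ℝ} (hY : Measurable Y)
    (hS : ∀ x, 0 < x → (μ {ω | x < Y ω}).toReal = S x) {a b : ℝ} (ha : 0 < a) (hab : a ≤ b) :
    (μ {ω | a < Y ω ∧ Y ω ≤ b}).toReal = S a - S b := by
  have h1 : {ω | a < Y ω ∧ Y ω ≤ b} = {ω | a < Y ω} \ {ω | b < Y ω} := by
    ext ω; simp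
  have h2 : MeasurableSet {ω | b < Y ω} := measurableSet_lt measurable_const hY
  have := measureReal_sdiff (μ := μ) (s₁ := {ω | a < Y ω}) (s₂ := {ω | b < Y ω})
    (fun ω h => lt_of_le_of_lt hab h) h2
  rw [h1, ← hS a ha, ← hS b (by linarith)]
  exact this

lemma trunc_pow_bound {Ω : Type*} {Y : Ω → ℝ} (hY0 : ∀ ω, 0 ≤ Y ω) {t p : ℝ} (ht : 0 ≤ t)
    (hp : 0 < p) (ω : Ω) :
    0 ≤ trunc Y t ω ^ p ∧ trunc Y t ω ^ p ≤ t ^ p := by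
  unfold trunc
  split_ifs with h
  · exact ⟨Real.rpow_nonneg (hY0 ω) _, Real.rpow_le_rpow (hY0 ω) h.le hp.le⟩
  · rw [Real.zero_rpow hp.ne']; exact ⟨le_rfl, Real.rpow_nonneg ht _⟩

lemma trunc_pow_meas {Ω : Type*} [MeasurableSpace Ω] {Y : Ω → ℝ} (hY : Measurable Y) (t p : ℝ) :
    Measurable (fun ω => trunc Y t ω ^ p) := by
  unfold trunc
  have : Measurable (fun ω => if Y ω < t then Y ω else 0) :=
    Measurable.ite (measurableSet_lt hY measurable_const) hY measurable_const
  exact this.pow_const p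

lemma integrable_of_bdd {Ω : Type*} [MeasurableSpace Ω] (μ : Measure Ω) [IsProbabilityMeasure μ]
    {U : Ω → ℝ} (hU : Measurable U) {B : ℝ} (h0 : ∀ ω, 0 ≤ U ω) (hB : ∀ ω, U ω ≤ B) :
    Integrable U μ := by
  refine Integrable.of_bound hU.aestronglyMeasurable B (ae_of_all _ fun ω => ?_)
  rw [Real.norm_of_nonneg (h0 ω)]; exact hB ω

lemma trunc_integrable {Ω : Type*} [MeasurableSpace Ω] (μ : Measure Ω) [IsProbabilityMeasure μ]
    {Y : Ω → ℝ} (hY : Measurable Y) (hY0 : ∀ ω, 0 ≤ Y ω) {t p : ℝ} (ht : 0 ≤ t)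
    (hp : 0 < p) : Integrable (fun ω => trunc Y t ω ^ p) μ :=
  integrable_of_bdd μ (trunc_pow_meas hY t p) (fun ω => (trunc_pow_bound hY0 ht hp ω).1)
    (fun ω => (trunc_pow_bound hY0 ht hp ω).2)

lemma moment_lower {S : ℝ → ℝ} {α p : ℝ} (H : RV S α) (hα : 0 < α) (hp : 0 < p) :
    ∃ C x0 : ℝ, 0 < C ∧ 0 < x0 ∧ ∀ {Ω : Type*} [MeasurableSpace Ω] (μ : Measure Ω)
      [IsProbabilityMeasure μ] (Y : Ω → ℝ), Measurable Y → (∀ ω, 0 ≤ Y ω) →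
      (∀ x, 0 < x → (μ {ω | x < Y ω}).toReal = S x) → ∀ t, x0 ≤ t →
      C * (t ^ p * S t) ≤ ∫ ω, trunc Y t ω ^ p ∂μ := by
  obtain ⟨x0, hx0, hd⟩ := H.dbl_upper (q := α / 2) (by linarith)
  have h2 : (1:ℝ) < 2 ^ (α/2) := Real.one_lt_rpow (by norm_num) (by linarith)
  refine ⟨(1/4) ^ p * (2 ^ (α/2) - 1), 4 * x0, ?_, by linarith, ?_⟩
  · have : 0 < (2:ℝ) ^ (α/2) - 1 := by linarith
    positivity
  intro Ω _ μ _ Y hY hY0 hS t ht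
  have htp : 0 < t := by linarith
  have e1 := tail_diff μ hY hS (a := t/4) (b := t/2) (by linarith) (by linarith)
  have hms : MeasurableSet {ω | t/4 < Y ω ∧ Y ω ≤ t/2} :=
    (measurableSet_lt measurable_const hY).inter (measurableSet_le hY measurable_const)
  have e2 : (t/4) ^ p * (S (t/4) - S (t/2)) ≤ ∫ ω, trunc Y t ω ^ p ∂μ := by
    rw [← e1]
    have : ∫ ω, Set.indicator {ω | t/4 < Y ω ∧ Y ω ≤ t/2} (fun _ => (t/4) ^ p) ω ∂μ
        = (t/4) ^ p * (μ {ω | t/4 < Y ω ∧ Y ω ≤ t/2}).toReal := by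
      rw [integral_indicator_const _ hms]
      simp [Measure.real, mul_comm]
    rw [← this]
    apply integral_mono
    · exact (integrable_const _).indicator hms
    · exact trunc_integrable μ hY hY0 htp.le hp
    · intro ω
      by_cases hω : ω ∈ {ω | t/4 < Y ω ∧ Y ω ≤ t/2}
      · simp only [Set.indicator_of_mem hω]
        have : Y ω < t := by have := hω.2; linarith
        simp only [trunc, this, if_true]
        exact Real.rpow_le_rpow (by linarith) hω.1.le hp.le
      · simp only [Set.indicator_of_notMem hω]
        exact (trunc_pow_bound hY0 htp.le hp ω).1
  have e3 := hd (t/4) (by linarith)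
  rw [show 2 * (t/4) = t/2 by ring] at e3
  have e4 : 2 ^ (α/2) * S (t/2) ≤ S (t/4) := by
    have h4 : (2:ℝ) ^ (α/2) * 2 ^ (-(α/2)) = 1 := by
      rw [← Real.rpow_add (by norm_num)]; simp
    calc 2 ^ (α/2) * S (t/2) ≤ 2 ^ (α/2) * (2 ^ (-(α/2)) * S (t/4)) := by gcongr
      _ = S (t/4) := by rw [← mul_assoc, h4, one_mul]
  have e5 := H.anti (t/2) t (by linarith) (by linarith)
  refine le_trans ?_ e2
  have e6 : (t/4) ^ p = (1/4) ^ p * t ^ p := by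
    rw [← Real.mul_rpow (by norm_num) htp.le]; congr 1; ring
  rw [e6]
  have e7 : (2 ^ (α/2) - 1) * S t ≤ S (t/4) - S (t/2) := by nlinarith
  calc (1/4) ^ p * (2 ^ (α/2) - 1) * (t ^ p * S t)
      = (1/4) ^ p * t ^ p * ((2 ^ (α/2) - 1) * S t) := by ring
    _ ≤ _ := by gcongr

lemma moment_upper {S : ℝ → ℝ} {α p : ℝ} (H : RV S α) (hα : 0 < α) (hp : α < p) :
    ∃ C x0 : ℝ, 0 < C ∧ 0 < x0 ∧ ∀ {Ω : Type*} [MeasurableSpace Ω] (μ : Measure Ω)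
      [IsProbabilityMeasure μ] (Y : Ω → ℝ), Measurable Y → (∀ ω, 0 ≤ Y ω) →
      (∀ x, 0 < x → (μ {ω | x < Y ω}).toReal = S x) → ∀ t, x0 ≤ t →
      ∫ ω, trunc Y t ω ^ p ∂μ ≤ C * (t ^ p * S t) := by
  have hp0 : 0 < p := by linarith
  obtain ⟨x0, hx0, hd⟩ := H.dbl_lower (q := (α + p) / 2) (by linarith)
  set q := (α + p) / 2 with hq
  have hρ : (1:ℝ) < 2 ^ (p - q) := Real.one_lt_rpow (by norm_num) (by rw [hq]; linarith)
  set ρ : ℝ := 2 ^ (p - q) with hρd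
  have hρ' : 0 < ρ - 1 := by linarith
  -- constants
  set C1 : ℝ := 2 ^ p * 2 ^ q with hC1
  have hC1p : 0 < C1 := by positivity
  set C2 : ℝ := (4 * x0) ^ p / ((2 * x0) ^ p * S (4 * x0)) with hC2
  have hS4 := H.pos (4 * x0) (by linarith)
  have hC2p : 0 < C2 := by positivity
  refine ⟨C1 / (ρ - 1) + C2, 2 * x0, by positivity, by linarith, ?_⟩
  intro Ω _ μ _ Y hY hY0 hS
  set K := C1 / (ρ - 1) + C2 with hK
  have hKC1 : C1 ≤ K * (ρ - 1) := by
    rw [hK, add_mul, div_mul_cancel₀ _ hρ'.ne']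
    have : 0 < C2 * (ρ - 1) := by positivity
    linarith
  have hKp : 0 < K := by positivity
  have base : ∀ s, 2 * x0 ≤ s → s ≤ 4 * x0 → ∫ ω, trunc Y s ω ^ p ∂μ ≤ K * (s ^ p * S s) := by
    intro s hs1 hs2
    have hsp : 0 < s := by linarith
    have h1 : ∫ ω, trunc Y s ω ^ p ∂μ ≤ (4 * x0) ^ p := by
      calc ∫ ω, trunc Y s ω ^ p ∂μ ≤ ∫ _ω, (4 * x0) ^ p ∂μ := by
            apply integral_mono (trunc_integrable μ hY hY0 hsp.le hp0) (integrable_const _)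
            intro ω
            exact (trunc_pow_bound hY0 hsp.le hp0 ω).2.trans
              (Real.rpow_le_rpow hsp.le hs2 hp0.le)
        _ = _ := by simp
    refine h1.trans ?_
    have h2 : (4 * x0) ^ p = C2 * ((2 * x0) ^ p * S (4 * x0)) := by
      rw [hC2, div_mul_cancel₀ _ (by positivity)]
    have h3 := H.anti s (4 * x0) hsp hs2
    have h4 : (2 * x0) ^ p ≤ s ^ p := Real.rpow_le_rpow (by linarith) hs1 hp0.le
    have h5 : C2 ≤ K := by
      rw [hK]; have : 0 < C1 / (ρ - 1) := by positivity
      linarith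
    rw [h2]
    gcongr
  have step : ∀ s, 2 * x0 ≤ s → ∫ ω, trunc Y s ω ^ p ∂μ ≤ K * (s ^ p * S s) →
      ∫ ω, trunc Y (2 * s) ω ^ p ∂μ ≤ K * ((2 * s) ^ p * S (2 * s)) := by
    intro s hs ih
    have hsp : 0 < s := by linarith
    have hms : MeasurableSet {ω | s / 2 < Y ω} := measurableSet_lt measurable_const hY
    have h1 : ∫ ω, trunc Y (2 * s) ω ^ p ∂μ
        ≤ ∫ ω, trunc Y s ω ^ p ∂μ + (2 * s) ^ p * S (s / 2) := by
      have e : ∫ ω, Set.indicator {ω | s / 2 < Y ω} (fun _ => (2 * s) ^ p) ω ∂μ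
        = (2 * s) ^ p * S (s / 2) := by
        rw [integral_indicator_const _ hms, ← hS _ (by linarith)]
        simp [Measure.real, mul_comm]
      rw [← e, ← integral_add (trunc_integrable μ hY hY0 hsp.le hp0)
        ((integrable_const _).indicator hms)]
      apply integral_mono (trunc_integrable μ hY hY0 (by linarith) hp0)
      · exact (trunc_integrable μ hY hY0 hsp.le hp0).add ((integrable_const _).indicator hms)
      intro ω
      have i0 : 0 ≤ Set.indicator {ω | s / 2 < Y ω} (fun _ => (2 * s) ^ p) ω :=
        Set.indicator_nonneg (fun _ _ => by positivity) ω
      by_cases hω : Y ω < s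
      · have e1 : trunc Y (2 * s) ω = trunc Y s ω := by
          simp only [trunc, hω, if_true]
          rw [if_pos (by linarith)]
        simp only [e1]
        linarith
      · have hm : ω ∈ {ω | s / 2 < Y ω} := by
          simp only [Set.mem_ofPred_eq]; push Not at hω; linarith
        simp only [Set.indicator_of_mem hm]
        have := (trunc_pow_bound hY0 hsp.le hp0 ω).1
        have := (trunc_pow_bound hY0 (t := 2 * s) (by linarith) hp0 ω).2
        linarith
    have h2 : S (s/2) ≤ 2 ^ q * S s := by
      have := hd (s/2) (by linarith)
      rw [show 2 * (s/2) = s by ring] at this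
      have h4 : (2:ℝ) ^ q * 2 ^ (-q) = 1 := by
        rw [← Real.rpow_add (by norm_num)]; simp
      calc S (s/2) = 2 ^ q * (2 ^ (-q) * S (s/2)) := by rw [← mul_assoc, h4, one_mul]
        _ ≤ _ := by gcongr
    have h3 := hd s (by linarith)
    have h4 : (2 * s) ^ p = 2 ^ p * s ^ p := Real.mul_rpow (by norm_num) hsp.le
    have hSs := H.pos s hsp
    have h5 : ρ * (s ^ p * S s) ≤ (2 * s) ^ p * S (2 * s) := by
      rw [h4, hρd, sub_eq_add_neg, Real.rpow_add (by norm_num)]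
      calc 2 ^ p * 2 ^ (-q) * (s ^ p * S s) = 2 ^ p * s ^ p * (2 ^ (-q) * S s) := by ring
        _ ≤ _ := by gcongr
    have h6 : (2 * s) ^ p * S (s / 2) ≤ C1 * (s ^ p * S s) := by
      rw [h4, hC1]
      calc 2 ^ p * s ^ p * S (s/2) ≤ 2 ^ p * s ^ p * (2 ^ q * S s) := by gcongr
        _ = _ := by ring
    have hz : 0 < s ^ p * S s := by positivity
    calc ∫ ω, trunc Y (2 * s) ω ^ p ∂μ ≤ K * (s ^ p * S s) + C1 * (s ^ p * S s) := by linarith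
      _ ≤ K * (s ^ p * S s) + (K * (ρ - 1)) * (s ^ p * S s) := by gcongr
      _ = K * (ρ * (s ^ p * S s)) := by ring
      _ ≤ _ := by gcongr
  have all : ∀ k : ℕ, ∀ s, 2 * x0 ≤ s → s ≤ 4 * x0 →
      ∫ ω, trunc Y (2 ^ k * s) ω ^ p ∂μ ≤ K * ((2 ^ k * s) ^ p * S (2 ^ k * s)) := by
    intro k s h1 h2
    induction k with
    | zero => simpa using base s h1 h2
    | succ k ih =>
      have := step (2 ^ k * s) (by
        have : (1:ℝ) ≤ 2 ^ k := one_le_pow₀ (by norm_num)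
        nlinarith) ih
      rw [show (2:ℝ) ^ (k+1) * s = 2 * (2 ^ k * s) by ring]
      exact this
  intro t ht
  obtain ⟨k, hk1, hk2⟩ := exists_nat_pow_near (x := t / (2 * x0)) (y := 2)
    ((one_le_div (by linarith)).2 ht) (by norm_num)
  rw [le_div_iff₀ (by linarith)] at hk1
  rw [div_lt_iff₀ (by linarith), pow_succ] at hk2
  have h2k : (0:ℝ) < 2 ^ k := by positivity
  have := all k (t / 2 ^ k) (by rw [le_div_iff₀ h2k]; linarith) (by
    rw [div_le_iff₀ h2k]; linarith)
  rwa [mul_div_cancel₀ _ h2k.ne'] at this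

lemma cheb {Ω : Type*} [MeasurableSpace Ω] (μ : Measure Ω) [IsProbabilityMeasure μ]
    (n : ℕ) (U : ℕ → Ω → ℝ) (hU : ∀ i, Measurable (U i)) {B : ℝ} (h0 : ∀ i ω, 0 ≤ U i ω)
    (hB : ∀ i ω, U i ω ≤ B) {A Q : ℝ} (hA : 0 < A)
    (hmean : A ≤ ∑ i ∈ Finset.range n, ∫ ω, U i ω ∂μ)
    (hsq : ∑ i ∈ Finset.range n, ∫ ω, U i ω ^ 2 ∂μ ≤ Q) :
    (μ {ω | ∑ i ∈ Finset.range n, U i ω ≤ A / 2}).toReal ≤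
      4 * (Q + ∑ i ∈ Finset.range n, ∑ j ∈ Finset.range n,
        if i = j then 0 else cov μ (U i) (U j)) / A ^ 2 := by
  have hint : ∀ i, Integrable (U i) μ := fun i => integrable_of_bdd μ (hU i) (h0 i) (hB i)
  have hint2 : ∀ i j, Integrable (fun ω => U i ω * U j ω) μ := fun i j =>
    integrable_of_bdd μ ((hU i).mul (hU j)) (B := B * B)
      (fun ω => mul_nonneg (h0 i ω) (h0 j ω))
      (fun ω => mul_le_mul (hB i ω) (hB j ω) (h0 j ω) ((h0 i ω).trans (hB i ω)))
  set Z : Ω → ℝ := fun ω => ∑ i ∈ Finset.range n, U i ω with hZ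
  have hZm : Measurable Z := Finset.measurable_sum _ fun i _ => hU i
  have hZB : ∀ ω, ‖Z ω‖ ≤ n * B := fun ω => by
    rw [Real.norm_of_nonneg (Finset.sum_nonneg fun i _ => h0 i ω)]
    calc Z ω ≤ ∑ i ∈ Finset.range n, B := Finset.sum_le_sum fun i _ => hB i ω
      _ = _ := by simp
  have hZ2 : MemLp Z 2 μ := MemLp.of_bound hZm.aestronglyMeasurable _ (ae_of_all _ hZB)
  have hEZ : ∫ ω, Z ω ∂μ = ∑ i ∈ Finset.range n, ∫ ω, U i ω ∂μ :=
    integral_finsetSum _ fun i _ => hint i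
  have hvar : ProbabilityTheory.variance Z μ ≤ Q + ∑ i ∈ Finset.range n, ∑ j ∈ Finset.range n,
        if i = j then 0 else cov μ (U i) (U j) := by
    rw [ProbabilityTheory.variance_eq_sub hZ2]
    have e1 : ∫ ω, (Z ^ 2) ω ∂μ
        = ∑ i ∈ Finset.range n, ∑ j ∈ Finset.range n, ∫ ω, U i ω * U j ω ∂μ := by
      have : ∀ ω, (Z ^ 2) ω = ∑ i ∈ Finset.range n, ∑ j ∈ Finset.range n, U i ω * U j ω := by
        intro ω
        simp only [Pi.pow_apply, hZ, sq, Finset.sum_mul_sum]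
      simp_rw [this]
      rw [integral_finsetSum _ fun i _ => integrable_finsetSum _ fun j _ => hint2 i j]
      exact Finset.sum_congr rfl fun i _ => integral_finsetSum _ fun j _ => hint2 i j
    rw [e1, hEZ, sq, Finset.sum_mul_sum, ← Finset.sum_sub_distrib]
    have e2 : ∀ i ∈ Finset.range n, (∑ j ∈ Finset.range n, ∫ ω, U i ω * U j ω ∂μ)
        - (∑ j ∈ Finset.range n, (∫ ω, U i ω ∂μ) * ∫ ω, U j ω ∂μ)
        ≤ ∫ ω, U i ω ^ 2 ∂μ + ∑ j ∈ Finset.range n, if i = j then 0 else cov μ (U i) (U j) := by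
      intro i hi
      rw [← Finset.sum_sub_distrib]
      have e3 : ∫ ω, U i ω ^ 2 ∂μ
          = ∑ j ∈ Finset.range n, if i = j then ∫ ω, U i ω ^ 2 ∂μ else 0 := by
        rw [Finset.sum_ite_eq, if_pos hi]
      rw [e3, ← Finset.sum_add_distrib]
      apply Finset.sum_le_sum
      intro j _
      split_ifs with hij
      · subst hij
        have := mul_self_nonneg (∫ ω, U i ω ∂μ)
        simp only [sq]; linarith
      · simp [cov]
    refine (Finset.sum_le_sum e2).trans ?_
    rw [Finset.sum_add_distrib]
    linarith
  have hch := ProbabilityTheory.meas_ge_le_variance_div_sq hZ2 (c := A / 2) (by linarith)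
  have hsub : {ω | Z ω ≤ A / 2} ⊆ {ω | A / 2 ≤ |Z ω - ∫ ω, Z ω ∂μ|} := by
    intro ω hω
    simp only [Set.mem_ofPred_eq] at hω ⊢
    rw [hEZ, abs_sub_comm]
    exact le_trans (by linarith) (le_abs_self _)
  have h1 := (measure_mono (μ := μ) hsub).trans hch
  have h2 : (μ {ω | Z ω ≤ A / 2}).toReal ≤ ProbabilityTheory.variance Z μ / (A/2) ^ 2 := by
    refine ENNReal.toReal_le_of_le_ofReal ?_ h1
    have := ProbabilityTheory.variance_nonneg Z μ
    positivity
  refine h2.trans ?_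
  rw [div_le_div_iff₀ (by positivity) (by positivity)]
  nlinarith [mul_le_mul_of_nonneg_right hvar (sq_nonneg A)]

lemma markov {Ω : Type*} [MeasurableSpace Ω] (μ : Measure Ω) [IsProbabilityMeasure μ]
    (n : ℕ) (U : ℕ → Ω → ℝ) (hU : ∀ i, Measurable (U i)) {B : ℝ} (h0 : ∀ i ω, 0 ≤ U i ω)
    (hB : ∀ i ω, U i ω ≤ B) {A K : ℝ} (hA : 0 < A) (hK : 0 < K)
    (hmean : ∑ i ∈ Finset.range n, ∫ ω, U i ω ∂μ ≤ A) :
    (μ {ω | K * A ≤ ∑ i ∈ Finset.range n, U i ω}).toReal ≤ 1 / K := by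
  have hint : ∀ i, Integrable (U i) μ := fun i => integrable_of_bdd μ (hU i) (h0 i) (hB i)
  have := mul_meas_ge_le_integral_of_nonneg (μ := μ) (f := fun ω => ∑ i ∈ Finset.range n, U i ω)
    (ae_of_all _ fun ω => Finset.sum_nonneg fun i _ => h0 i ω)
    (integrable_finsetSum _ fun i _ => hint i) (K * A)
  rw [integral_finsetSum _ fun i _ => hint i] at this
  simp only [Measure.real] at this
  rw [le_div_iff₀ hK]
  have h3 : A * ((μ {ω | K * A ≤ ∑ i ∈ Finset.range n, U i ω}).toReal * K) ≤ A * 1 := by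
    linarith
  exact le_of_mul_le_mul_left h3 hA

set_option maxHeartbeats 1000000 in
lemma log_algebra (α h δ K ρ κ : ℝ) (hα : 0 < α) (hα1 : α < 1) (hh : 1 < h) (hδ : 0 ≤ δ)
    (hK : 0 ≤ K) (hρ : 0 ≤ ρ) (hκ : 0 < κ) :
    ∃ C : ℝ, 0 < C ∧ ∀ ℓ lam T V D Lt Lb Lbt Y W Z : ℝ, 1 ≤ lam → 0 < ℓ →
      |ℓ + lam - α * T + Lt| ≤ 1 → |D - (T - ℓ - lam)| ≤ K → V ≤ T → T ≤ V + ρ * lam + K →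
      Z ≤ lam + D → V + lam - ℓ - K ≤ Z →
      W ≤ lam + ℓ - α * (D - 2 * δ * lam) + Lb → ℓ - α * (D + lam) + Lbt - 1 ≤ W →
      Y ≤ h * (ℓ + Z) → h * V + lam - K ≤ Y → κ * ℓ ≤ Z →
      |(Y - W) / Z - (h - α ^ 2) / (1 - α)| ≤ C * ((lam + |Lt| + |Lb| + |Lbt|) / ℓ) := by
  set r := (h - α ^ 2) / (1 - α) with hr
  have h1α : 0 < 1 - α := by linarith
  have hrp : 0 < r := div_pos (by nlinarith) h1α
  have hr2 : h / α - α = r * (1 / α - 1) := by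
    rw [hr]; field_simp
  set k1 := 2 / α with hk1
  have hk1p : 0 < k1 := by positivity
  set k2 := k1 + K + 1 with hk2
  set k3 := k1 + ρ + K with hk3
  set k4 := k2 + 1 + k3 + K with hk4
  set k5 := 2 + α * k2 + 2 * α * δ + α + 1 with hk5
  set k6 := h * k4 + h * k3 + K + 1 with hk6
  have p2 : 0 < k2 := by positivity
  have p3 : 0 < k3 := by positivity
  have p4 : 0 < k4 := by positivity
  have p5 : 0 < k5 := by positivity
  have p6 : 0 < k6 := by positivity
  refine ⟨(k6 + k5 + r * k4) / κ, by positivity, ?_⟩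
  intro ℓ lam T V D Lt Lb Lbt Y W Z hlam hℓ h1 h2 h3 h4 h5 h6 h7 h8 h9 h10 h11
  set L := lam + |Lt| + |Lb| + |Lbt| with hL
  have a1 := abs_nonneg Lt
  have a2 := abs_nonneg Lb
  have a3 := abs_nonneg Lbt
  have b1 := abs_le.1 (le_refl |Lt|)
  have b2 := abs_le.1 (le_refl |Lb|)
  have b3 := abs_le.1 (le_refl |Lbt|)
  have hL1 : 1 ≤ L := by linarith
  have hlL : lam ≤ L := by linarith
  have hKL : K ≤ K * L := by nlinarith
  have hρL : ρ * lam ≤ ρ * L := by gcongr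
  have hρL0 : 0 ≤ ρ * L := by positivity
  have hKL0 : 0 ≤ K * L := by positivity
  rw [abs_le] at h1 h2
  have hT : |T - ℓ / α| ≤ k1 * L := by
    have e : T - ℓ / α = (lam + Lt - (ℓ + lam - α * T + Lt)) / α := by field_simp; ring
    rw [e, abs_div, abs_of_pos hα, hk1, div_mul_eq_mul_div]
    apply div_le_div_of_nonneg_right _ hα.le
    rw [abs_le]; constructor <;> linarith
  rw [abs_le] at hT
  have hD : |D - (ℓ / α - ℓ)| ≤ k2 * L := by
    rw [hk2, abs_le]; constructor <;> linarith
  have hV : |V - ℓ / α| ≤ k3 * L := by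
    rw [hk3, abs_le]; constructor <;> linarith
  rw [abs_le] at hD hV
  have hZ : |Z - (ℓ / α - ℓ)| ≤ k4 * L := by
    have : 0 < k2 * L := by positivity
    have : 0 < k3 * L := by positivity
    rw [hk4, abs_le]; constructor <;> linarith
  rw [abs_le] at hZ
  have hαD1 : α * D ≤ ℓ - α * ℓ + α * (k2 * L) := by
    have : α * D ≤ α * (ℓ / α - ℓ + k2 * L) := mul_le_mul_of_nonneg_left (by linarith) (by linarith)
    have e : α * (ℓ / α - ℓ + k2 * L) = ℓ - α * ℓ + α * (k2 * L) := by field_simp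
    linarith
  have hαD2 : ℓ - α * ℓ - α * (k2 * L) ≤ α * D := by
    have : α * (ℓ / α - ℓ - k2 * L) ≤ α * D := mul_le_mul_of_nonneg_left (by linarith) (by linarith)
    have e : α * (ℓ / α - ℓ - k2 * L) = ℓ - α * ℓ - α * (k2 * L) := by field_simp
    linarith
  have hW : |W - α * ℓ| ≤ k5 * L := by
    have q1 : α * δ * lam ≤ α * δ * L := by gcongr
    have q2 : α * lam ≤ α * L := by gcongr
    have q3 : 0 ≤ α * δ * L := by positivity
    have q4 : 0 ≤ α * L := by positivity
    rw [hk5, abs_le]; constructor <;> linarith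
  rw [abs_le] at hW
  have hY : |Y - h * (ℓ / α)| ≤ k6 * L := by
    have q1 : h * (ℓ + Z) ≤ h * (ℓ / α + k4 * L) := mul_le_mul_of_nonneg_left (by linarith) (by linarith)
    have q2 : h * (ℓ / α - k3 * L) ≤ h * V := mul_le_mul_of_nonneg_left (by linarith) (by linarith)
    have q3 : 0 ≤ h * k4 * L := by positivity
    have q4 : 0 ≤ h * k3 * L := by positivity
    rw [hk6, abs_le]; constructor <;> linarith
  rw [abs_le] at hY
  have hZp : 0 < Z := lt_of_lt_of_le (by positivity) h11
  have hfin : |Y - W - r * Z| ≤ (k6 + k5 + r * k4) * L := by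
    have e : h * (ℓ / α) - α * ℓ = r * (ℓ / α - ℓ) := by
      have : h * (ℓ / α) - α * ℓ = (h / α - α) * ℓ := by ring
      rw [this, hr2]; ring
    have q1 : r * Z ≤ r * (ℓ / α - ℓ + k4 * L) := mul_le_mul_of_nonneg_left (by linarith) (by linarith)
    have q2 : r * (ℓ / α - ℓ - k4 * L) ≤ r * Z := mul_le_mul_of_nonneg_left (by linarith) (by linarith)
    rw [abs_le]; constructor <;> linarith
  have e : (Y - W) / Z - r = (Y - W - r * Z) / Z := by field_simp
  rw [e, abs_div, abs_of_pos hZp]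
  calc |Y - W - r * Z| / Z ≤ ((k6 + k5 + r * k4) * L) / (κ * ℓ) := by gcongr
    _ = _ := mul_div_mul_comm _ _ _ _

lemma ev_log_of_tendsto_one {f : ℕ → ℝ} (hf : Tendsto f atTop (nhds 1)) :
    ∀ᶠ n in atTop, |Real.log (f n)| ≤ 1 := by
  have h1 : Tendsto (fun n => |Real.log (f n)|) atTop (nhds 0) := by
    have := (hf.log one_ne_zero).abs
    simpa using this
  exact (h1.eventually (gt_mem_nhds (by norm_num : (0:ℝ) < 1))).mono fun n hn => hn.le

lemma tendsto_top_of_surv {S : ℝ → ℝ} {α : ℝ} (H : RV S α) {t : ℕ → ℝ} (htp : ∀ n, 0 < t n)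
    (h : Tendsto (fun n => S (t n)) atTop (nhds 0)) : Tendsto t atTop atTop := by
  rw [tendsto_atTop]
  intro a
  have hm : 0 < max a 1 := by positivity
  filter_upwards [h.eventually (gt_mem_nhds (H.pos _ hm))] with n hn
  by_contra hlt
  push Not at hlt
  have := H.anti (t n) (max a 1) (htp n) (hlt.le.trans (le_max_left _ _))
  linarith

lemma ev_small {c : ℕ → ℝ}
    (hclog : Tendsto (fun n : ℕ => Real.log (c n) / Real.log n) atTop (nhds 0))
    (A B ε : ℝ) (hε : 0 < ε) :
    ∀ᶠ n : ℕ in atTop, A * Real.log (c n) + B ≤ ε * Real.log n := by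
  have hl : Tendsto (fun n : ℕ => Real.log (n:ℝ)) atTop atTop :=
    Real.tendsto_log_atTop.comp tendsto_natCast_atTop_atTop
  have h1 : Tendsto (fun n : ℕ => A * (Real.log (c n) / Real.log n) + B * (Real.log n)⁻¹) atTop
      (nhds 0) := by
    have := (hclog.const_mul A).add ((tendsto_inv_atTop_zero.comp hl).const_mul B)
    simpa using this
  filter_upwards [h1.eventually (gt_mem_nhds hε), hl.eventually_gt_atTop 0] with n h2 h3
  have : (A * (Real.log (c n) / Real.log n) + B * (Real.log n)⁻¹) * Real.log n
      = A * Real.log (c n) + B := by field_simp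
  rw [← this]
  gcongr

/-- Deterministic asymptotics, in logarithmic form. -/
lemma asymp {S l : ℝ → ℝ} {α : ℝ} (hα : 0 < α) (hα1 : α < 1) (H : RV S α)
    (hSl : ∀ x, 0 < x → S x = x ^ (-α) * l x)
    (c : ℕ → ℝ) (hc : ∀ n, 0 < c n) (hctop : Tendsto c atTop atTop)
    (hclog : Tendsto (fun n : ℕ => Real.log (c n) / Real.log n) atTop (nhds 0))
    (t : ℕ → ℝ) (htpos : ∀ n, 0 < t n)
    (ht : Tendsto (fun n : ℕ => (n : ℝ) * c n * l (t n) / t n ^ α) atTop (nhds 1))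
    (v : ℕ → ℝ) (hvpos : ∀ n, 0 < v n)
    (hv : Tendsto (fun n : ℕ => (n : ℝ) * l (v n) / (v n ^ α * c n)) atTop (nhds 1))
    (d : ℕ → ℝ) (C1 C2 x0 : ℝ) (hC1 : 0 < C1) (hC2 : 0 < C2)
    (hd : ∀ n, x0 ≤ t n → C1 * (t n * S (t n)) ≤ d n ∧ d n ≤ C2 * (t n * S (t n))) :
    Tendsto t atTop atTop ∧ Tendsto v atTop atTop ∧
    ∃ K : ℝ, 0 ≤ K ∧ ∀ᶠ n : ℕ in atTop, 2 ≤ n ∧ 0 < Real.log n ∧ 1 ≤ Real.log (c n) ∧ 0 < d n ∧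
      |Real.log n + Real.log (c n) + Real.log (S (t n))| ≤ 1 ∧
      |Real.log n - Real.log (c n) + Real.log (S (v n))| ≤ 1 ∧
      |Real.log (d n) - (Real.log (t n) - Real.log n - Real.log (c n))| ≤ K ∧
      Real.log (v n) ≤ Real.log (t n) ∧
      Real.log (t n) ≤ Real.log (v n) + (4 / α - 2) * Real.log (c n) + K ∧
      Real.log n - Real.log (c n) - K ≤ (1 + α) / 2 * Real.log (v n) := by
  have hl : Tendsto (fun n : ℕ => Real.log (n:ℝ)) atTop atTop :=
    Real.tendsto_log_atTop.comp tendsto_natCast_atTop_atTop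
  have hlc : Tendsto (fun n : ℕ => Real.log (c n)) atTop atTop :=
    Real.tendsto_log_atTop.comp hctop
  have ht' : Tendsto (fun n : ℕ => (n : ℝ) * c n * S (t n)) atTop (nhds 1) := by
    refine ht.congr fun n => ?_
    rw [hSl _ (htpos n), Real.rpow_neg (htpos n).le]; field_simp
  have hv' : Tendsto (fun n : ℕ => (n : ℝ) / c n * S (v n)) atTop (nhds 1) := by
    refine hv.congr fun n => ?_
    rw [hSl _ (hvpos n), Real.rpow_neg (hvpos n).le]
    have := hc n
    have := Real.rpow_pos_of_pos (hvpos n) α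
    field_simp
  have f1 : ∀ᶠ n : ℕ in atTop, |Real.log n + Real.log (c n) + Real.log (S (t n))| ≤ 1 := by
    filter_upwards [ev_log_of_tendsto_one ht', eventually_ge_atTop 1] with n hn h1
    have hn0 : (n:ℝ) ≠ 0 := by positivity
    rwa [Real.log_mul (mul_ne_zero hn0 (hc n).ne') (H.pos _ (htpos n)).ne',
      Real.log_mul hn0 (hc n).ne'] at hn
  have f2 : ∀ᶠ n : ℕ in atTop, |Real.log n - Real.log (c n) + Real.log (S (v n))| ≤ 1 := by
    filter_upwards [ev_log_of_tendsto_one hv', eventually_ge_atTop 1] with n hn h1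
    have hn0 : (n:ℝ) ≠ 0 := by positivity
    rwa [Real.log_mul (div_ne_zero hn0 (hc n).ne') (H.pos _ (hvpos n)).ne',
      Real.log_div hn0 (hc n).ne'] at hn
  have topS : ∀ w : ℕ → ℝ, (∀ n, 0 < w n) →
      Tendsto (fun n => Real.log (S (w n))) atTop atBot → Tendsto w atTop atTop := by
    intro w hw h
    apply tendsto_top_of_surv H hw
    have := Real.tendsto_exp_atBot.comp h
    refine this.congr fun n => ?_
    simp [Real.exp_log (H.pos _ (hw n))]
  have htT : Tendsto t atTop atTop := by
    apply topS t htpos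
    apply tendsto_atBot_mono' (f₁ := fun n : ℕ => -(Real.log (n:ℝ)) + 1)
    · filter_upwards [f1, hlc.eventually_ge_atTop 0] with n h1 h2
      rw [abs_le] at h1; linarith
    · exact tendsto_atBot_add_const_right _ _ (tendsto_neg_atTop_atBot.comp hl)
  have hvT : Tendsto v atTop atTop := by
    apply topS v hvpos
    apply tendsto_atBot_mono' (f₁ := fun n : ℕ => -(1/2 * Real.log (n:ℝ)) + 1)
    · filter_upwards [f2, ev_small hclog 1 0 (1/2) (by norm_num)] with n h1 h2
      rw [abs_le] at h1; linarith
    · exact tendsto_atBot_add_const_right _ _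
        (tendsto_neg_atTop_atBot.comp (hl.const_mul_atTop (by norm_num)))
  refine ⟨htT, hvT, ?_⟩
  -- Potter constants
  set q := α / (2 - α) with hq
  have h2α : 0 < 2 - α := by linarith
  have hqp : 0 < q := by positivity
  have hqα : q < α := by rw [hq, div_lt_iff₀ h2α]; nlinarith
  obtain ⟨x1, hx1, hd1⟩ := H.dbl_upper hqα
  have P1 := rv_upper H.anti H.pos hx1 hqp hd1
  set q2 := (1 + α) / 2 with hq2
  have hq2p : 0 < q2 := by positivity
  obtain ⟨x2, hx2, hd2⟩ := H.dbl_lower (q := q2) (by rw [hq2]; linarith)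
  have P2 := rv_lower H.anti H.pos hx2 hq2p hd2
  set K1 := |Real.log C1| + |Real.log C2| + 1 with hK1
  set K2 := |(2 + q * Real.log 2) / q| with hK2
  set K3 := |1 + q2 * Real.log 2 - q2 * Real.log x2 - Real.log (S x2)| with hK3
  refine ⟨K1 + K2 + K3, by positivity, ?_⟩
  have k1 : 0 ≤ K1 := by positivity
  have k2 : 0 ≤ K2 := by positivity
  have k3 : 0 ≤ K3 := by positivity
  filter_upwards [f1, f2, eventually_ge_atTop 2, hl.eventually_gt_atTop 0,
    hlc.eventually_gt_atTop 1, htT.eventually_ge_atTop x0, hvT.eventually_ge_atTop x1,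
    hvT.eventually_ge_atTop x2] with n g1 g2 g3 g4 g5 g6 g7 g8
  have hSt := H.pos _ (htpos n)
  have hSv := H.pos _ (hvpos n)
  obtain ⟨d1, d2⟩ := hd n g6
  have htn := htpos n
  have hvn := hvpos n
  have hdp : 0 < d n := lt_of_lt_of_le (by positivity) d1
  have hg1 := abs_le.1 g1
  have hg2 := abs_le.1 g2
  have hvt : v n ≤ t n := by
    by_contra hlt
    push Not at hlt
    have := Real.log_le_log hSv (H.anti _ _ htn hlt.le)
    linarith
  refine ⟨g3, g4, g5.le, hdp, g1, g2, ?_, Real.log_le_log hvn hvt, ?_, ?_⟩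
  · have e1 := Real.log_le_log (by positivity) d1
    have e2 := Real.log_le_log hdp d2
    rw [Real.log_mul hC1.ne' (by positivity), Real.log_mul htn.ne' hSt.ne'] at e1
    rw [Real.log_mul hC2.ne' (by positivity), Real.log_mul htn.ne' hSt.ne'] at e2
    have := neg_abs_le (Real.log C1)
    have := le_abs_self (Real.log C2)
    have := abs_nonneg (Real.log C1)
    have := abs_nonneg (Real.log C2)
    rw [abs_le]; constructor <;> linarith
  · have e1 := P1 (v n) (t n) g7 hvt
    have e2 := Real.log_le_log (by positivity) e1
    rw [Real.log_mul (by positivity) hSt.ne', Real.log_mul (by positivity) hSv.ne',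
      Real.log_rpow (by positivity), Real.log_rpow (by norm_num),
      Real.log_div htn.ne' hvn.ne'] at e2
    have e3 : q * (Real.log (t n) - Real.log (v n)) ≤ 2 * Real.log (c n) + (2 + q * Real.log 2) := by
      linarith
    have e4 : Real.log (t n) - Real.log (v n)
        ≤ (2 * Real.log (c n) + (2 + q * Real.log 2)) / q := by
      rw [le_div_iff₀ hqp]; linarith
    have e5 : 2 / q = 4 / α - 2 := by rw [hq]; field_simp; ring
    have e6 : (2 * Real.log (c n) + (2 + q * Real.log 2)) / q
        = (4 / α - 2) * Real.log (c n) + (2 + q * Real.log 2) / q := by rw [← e5]; ring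
    have := le_abs_self ((2 + q * Real.log 2) / q)
    linarith
  · have e1 := P2 x2 (v n) le_rfl g8
    have e2 := Real.log_le_log (H.pos _ hx2) e1
    rw [Real.log_mul (by positivity) (by positivity), Real.log_mul (by positivity) hSv.ne',
      Real.log_rpow (by norm_num), Real.log_rpow (div_pos hvn hx2),
      Real.log_div hvn.ne' hx2.ne'] at e2
    have := le_abs_self (1 + q2 * Real.log 2 - q2 * Real.log x2 - Real.log (S x2))
    linarith

lemma trunc_le {Ω : Type*} {Y : Ω → ℝ} (hY0 : ∀ ω, 0 ≤ Y ω) (t : ℝ) (ω : Ω) :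
    0 ≤ trunc Y t ω ∧ trunc Y t ω ≤ Y ω := by
  unfold trunc
  split_ifs
  · exact ⟨hY0 ω, le_rfl⟩
  · exact ⟨le_rfl, hY0 ω⟩

lemma event1 {Ω : Type*} [MeasurableSpace Ω] (μ : Measure Ω) [IsProbabilityMeasure μ]
    (X : ℕ → Ω → ℝ) (hXmeas : ∀ i, Measurable (X i)) (hXnn : ∀ i ω, 0 ≤ X i ω)
    {S : ℝ → ℝ} {α : ℝ} (H : RV S α) (hα1 : α < 1)
    (hS : ∀ i, ∀ x : ℝ, 0 < x → (μ {ω | x < X i ω}).toReal = S x)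
    (c : ℕ → ℝ) (hc : ∀ n, 0 < c n) (hctop : Tendsto c atTop atTop)
    (t : ℕ → ℝ) (htpos : ∀ n, 0 < t n) (htT : Tendsto t atTop atTop)
    (d : ℕ → ℝ) (A C : ℝ) (hC : 0 < C)
    (hA : ∀ᶠ n : ℕ in atTop, (n:ℝ) * S (t n) ≤ A / c n)
    (hd : ∀ᶠ n : ℕ in atTop, 0 < d n ∧ ∀ i, ∫ ω, trunc (X i) (t n) ω ^ (1:ℝ) ∂μ ≤ C * d n) :
    Tendsto (fun n => (μ {ω | d n * c n < sampleMoment X 1 n ω}).toReal) atTop (nhds 0) := by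
  obtain ⟨x0, hx0, hdb⟩ := H.dbl_lower hα1
  have hlim : Tendsto (fun n => 2 * (A / c n) + C / c n) atTop (nhds 0) := by
    have h1 : Tendsto (fun n => A / c n) atTop (nhds 0) := hctop.const_div_atTop A
    have h2 : Tendsto (fun n => C / c n) atTop (nhds 0) := hctop.const_div_atTop C
    simpa using (h1.const_mul 2).add h2
  refine squeeze_zero' (Eventually.of_forall fun n => ENNReal.toReal_nonneg) ?_ hlim
  filter_upwards [hA, hd, htT.eventually_ge_atTop (2 * x0), eventually_ge_atTop 1]
    with n h1 h2 h3 h4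
  obtain ⟨hdp, h2⟩ := h2
  have hn : (0:ℝ) < n := by positivity
  have htn := htpos n
  have hcn := hc n
  have hsub : {ω | d n * c n < sampleMoment X 1 n ω} ⊆
      (⋃ i ∈ Finset.range n, {ω | t n / 2 < X i ω}) ∪
      {ω | c n / C * (n * (C * d n)) ≤ ∑ i ∈ Finset.range n, trunc (X i) (t n) ω ^ (1:ℝ)} := by
    intro ω hω
    by_cases hex : ∃ i ∈ Finset.range n, t n / 2 < X i ω
    · left
      obtain ⟨i, hi, hxi⟩ := hex
      simp only [Set.mem_iUnion]
      exact ⟨i, hi, hxi⟩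
    · right
      push Not at hex
      simp only [Set.mem_ofPred_eq] at hω ⊢
      have e : ∑ i ∈ Finset.range n, trunc (X i) (t n) ω ^ (1:ℝ)
          = ∑ i ∈ Finset.range n, X i ω ^ (1:ℝ) := by
        refine Finset.sum_congr rfl fun i hi => ?_
        have := hex i hi
        rw [trunc, if_pos (by linarith)]
      rw [e]
      unfold sampleMoment at hω
      have e2 : c n / C * (n * (C * d n)) = n * (d n * c n) := by field_simp
      rw [e2]
      have := mul_lt_mul_of_pos_left hω hn
      rw [mul_inv_cancel_left₀ hn.ne'] at this
      exact this.le
  have m1 : (μ (⋃ i ∈ Finset.range n, {ω | t n / 2 < X i ω})).toReal ≤ 2 * (A / c n) := by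
    have := measureReal_biUnion_finset_le (μ := μ) (Finset.range n) (fun i => {ω | t n / 2 < X i ω})
    refine le_trans this ?_
    have e : ∀ i ∈ Finset.range n, μ.real {ω | t n / 2 < X i ω} ≤ 2 * S (t n) := by
      intro i _
      rw [Measure.real, hS i _ (by linarith)]
      have := hdb (t n / 2) (by linarith)
      rw [show 2 * (t n / 2) = t n by ring, Real.rpow_neg_one] at this
      linarith
    refine (Finset.sum_le_sum e).trans ?_
    rw [Finset.sum_const, Finset.card_range, nsmul_eq_mul]
    linarith
  have m2 := markov μ n (fun i ω => trunc (X i) (t n) ω ^ (1:ℝ))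
    (fun i => trunc_pow_meas (hXmeas i) _ _)
    (fun i ω => (trunc_pow_bound (hXnn i) htn.le one_pos ω).1)
    (fun i ω => (trunc_pow_bound (hXnn i) htn.le one_pos ω).2)
    (A := n * (C * d n)) (K := c n / C) (by positivity) (by positivity) (by
      refine (Finset.sum_le_sum fun i _ => h2 i).trans ?_
      rw [Finset.sum_const, Finset.card_range, nsmul_eq_mul])
  rw [one_div_div] at m2
  have m3 := measureReal_mono (μ := μ) hsub
  have m4 := measureReal_union_le (μ := μ) (⋃ i ∈ Finset.range n, {ω | t n / 2 < X i ω})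
    {ω | c n / C * (n * (C * d n)) ≤ ∑ i ∈ Finset.range n, trunc (X i) (t n) ω ^ (1:ℝ)}
  simp only [Measure.real] at m3 m4
  linarith

lemma event23 {Ω : Type*} [MeasurableSpace Ω] (μ : Measure Ω) [IsProbabilityMeasure μ]
    (X : ℕ → Ω → ℝ) (hXmeas : ∀ i, Measurable (X i)) (hXnn : ∀ i ω, 0 ≤ X i ω)
    {S : ℝ → ℝ} {α : ℝ} (H : RV S α) (hα : 0 < α) (hα1 : α < 1)
    (hS : ∀ i, ∀ x : ℝ, 0 < x → (μ {ω | x < X i ω}).toReal = S x)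
    (c : ℕ → ℝ) (hc : ∀ n, 0 < c n) (hctop : Tendsto c atTop atTop)
    (v : ℕ → ℝ) (hvpos : ∀ n, 0 < v n) (hvT : Tendsto v atTop atTop)
    (A1 A2 : ℝ) (hA1 : 0 < A1)
    (hA : ∀ᶠ n : ℕ in atTop, A1 * c n ≤ (n:ℝ) * S (v n) ∧ (n:ℝ) * S (v n) ≤ A2 * c n)
    (p : ℝ) (hp : 1 ≤ p) (hcond : ConditionA μ X v c p) :
    ∃ κ : ℝ, 0 < κ ∧ Tendsto (fun n =>
      (μ {ω | ∑ i ∈ Finset.range n, X i ω ^ p ≤ κ * (v n ^ p * c n)}).toReal) atTop (nhds 0) := by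
  have hp0 : 0 < p := by linarith
  obtain ⟨C1, x1, hC1, hx1, hlow⟩ := moment_lower H hα hp0
  obtain ⟨C2, x2, hC2, hx2, hup⟩ := moment_upper H hα (p := 2 * p) (by linarith)
  refine ⟨C1 * A1 / 2, by positivity, ?_⟩
  have hlim : Tendsto (fun n => 4 / (C1 * A1) ^ 2 * (C2 * A2 / c n +
      covSum μ X v p n / (v n ^ (2 * p) * c n ^ 2))) atTop (nhds 0) := by
    have h1 : Tendsto (fun n => C2 * A2 / c n) atTop (nhds 0) := hctop.const_div_atTop _
    simpa using (h1.add hcond).const_mul (4 / (C1 * A1) ^ 2)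
  refine squeeze_zero' (Eventually.of_forall fun n => ENNReal.toReal_nonneg) ?_ hlim
  filter_upwards [hA, hvT.eventually_ge_atTop x1, hvT.eventually_ge_atTop x2] with n h1 h2 h3
  have hvn := hvpos n
  have hcn := hc n
  have hvp : 0 < v n ^ p := by positivity
  have e2p : v n ^ (2 * p) = (v n ^ p) ^ 2 := by
    rw [← Real.rpow_natCast, ← Real.rpow_mul hvn.le, mul_comm]; norm_num
  have m2 := cheb μ n (fun i ω => trunc (X i) (v n) ω ^ p)
    (fun i => trunc_pow_meas (hXmeas i) _ _)
    (fun i ω => (trunc_pow_bound (hXnn i) hvn.le hp0 ω).1)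
    (fun i ω => (trunc_pow_bound (hXnn i) hvn.le hp0 ω).2)
    (A := C1 * A1 * (v n ^ p * c n)) (Q := C2 * A2 * (v n ^ (2 * p) * c n)) (by positivity)
    (by
      have : ∑ i ∈ Finset.range n, C1 * (v n ^ p * S (v n))
          ≤ ∑ i ∈ Finset.range n, ∫ ω, trunc (X i) (v n) ω ^ p ∂μ :=
        Finset.sum_le_sum fun i _ => hlow μ (X i) (hXmeas i) (hXnn i) (hS i) (v n) h2
      refine le_trans ?_ this
      rw [Finset.sum_const, Finset.card_range, nsmul_eq_mul]
      calc C1 * A1 * (v n ^ p * c n) = C1 * v n ^ p * (A1 * c n) := by ring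
        _ ≤ C1 * v n ^ p * (n * S (v n)) := mul_le_mul_of_nonneg_left h1.1 (by positivity)
        _ = _ := by ring)
    (by
      have : ∑ i ∈ Finset.range n, ∫ ω, (trunc (X i) (v n) ω ^ p) ^ 2 ∂μ
          ≤ ∑ i ∈ Finset.range n, C2 * (v n ^ (2 * p) * S (v n)) := by
        refine Finset.sum_le_sum fun i _ => ?_
        have := hup μ (X i) (hXmeas i) (hXnn i) (hS i) (v n) h3
        refine le_trans (le_of_eq ?_) this
        congr 1; ext ω
        rw [← Real.rpow_natCast, ← Real.rpow_mul (trunc_le (hXnn i) _ ω).1, mul_comm]; norm_num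
      refine this.trans ?_
      rw [Finset.sum_const, Finset.card_range, nsmul_eq_mul]
      calc n * (C2 * (v n ^ (2 * p) * S (v n))) = C2 * v n ^ (2 * p) * (n * S (v n)) := by ring
        _ ≤ C2 * v n ^ (2 * p) * (A2 * c n) := mul_le_mul_of_nonneg_left h1.2 (by positivity)
        _ = _ := by ring)
  have hsub : {ω | ∑ i ∈ Finset.range n, X i ω ^ p ≤ C1 * A1 / 2 * (v n ^ p * c n)} ⊆
      {ω | ∑ i ∈ Finset.range n, trunc (X i) (v n) ω ^ p ≤ C1 * A1 * (v n ^ p * c n) / 2} := by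
    intro ω hω
    simp only [Set.mem_ofPred_eq] at hω ⊢
    have : ∑ i ∈ Finset.range n, trunc (X i) (v n) ω ^ p ≤ ∑ i ∈ Finset.range n, X i ω ^ p :=
      Finset.sum_le_sum fun i _ => Real.rpow_le_rpow (trunc_le (hXnn i) _ ω).1
        (trunc_le (hXnn i) _ ω).2 hp0.le
    linarith
  have m3 := measureReal_mono (μ := μ) hsub
  simp only [Measure.real] at m3
  refine (m3.trans m2).trans (le_of_eq ?_)
  rw [e2p]
  change 4 * (C2 * A2 * ((v n ^ p) ^ 2 * c n) + covSum μ X v p n) / _ = _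
  field_simp

lemma integral_ind {Ω : Type*} [MeasurableSpace Ω] (μ : Measure Ω) [IsProbabilityMeasure μ]
    {Y : Ω → ℝ} (hY : Measurable Y) (b : ℝ) :
    ∫ ω, (if b < Y ω then (1:ℝ) else 0) ∂μ = (μ {ω | b < Y ω}).toReal := by
  have hms : MeasurableSet {ω | b < Y ω} := measurableSet_lt measurable_const hY
  have : (fun ω => if b < Y ω then (1:ℝ) else 0) = Set.indicator {ω | b < Y ω} (fun _ => 1) := by
    ext ω; simp [Set.indicator]
  rw [this, integral_indicator_const _ hms]
  simp [Measure.real]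

lemma ind_meas {Ω : Type*} [MeasurableSpace Ω] {Y : Ω → ℝ} (hY : Measurable Y) (b : ℝ) :
    Measurable (fun ω => if b < Y ω then (1:ℝ) else 0) :=
  Measurable.ite (measurableSet_lt measurable_const hY) measurable_const measurable_const

lemma event4 {Ω : Type*} [MeasurableSpace Ω] (μ : Measure Ω) [IsProbabilityMeasure μ]
    (X : ℕ → Ω → ℝ) (hXmeas : ∀ i, Measurable (X i))
    {S : ℝ → ℝ} {α : ℝ} (H : RV S α)
    (hS : ∀ i, ∀ x : ℝ, 0 < x → (μ {ω | x < X i ω}).toReal = S x)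
    (n : ℕ) (hn : 1 ≤ n) (b c : ℝ) (hb : 0 < b) (hc : 0 < c) :
    (μ {ω | c * (n * S b) ≤ ∑ i ∈ Finset.range n, if b < X i ω then (1:ℝ) else 0}).toReal
      ≤ 1 / c := by
  have hSb := H.pos b hb
  have hn' : (0:ℝ) < n := by positivity
  refine markov μ n (fun i ω => if b < X i ω then (1:ℝ) else 0) (fun i => ind_meas (hXmeas i) b)
    (B := 1) (fun i ω => by split_ifs <;> norm_num)
    (fun i ω => by split_ifs <;> norm_num) (by positivity) hc ?_
  refine le_of_eq ?_
  simp_rw [integral_ind μ (hXmeas _), hS _ b hb]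
  simp

lemma event5 {Ω : Type*} [MeasurableSpace Ω] (μ : Measure Ω) [IsProbabilityMeasure μ]
    (X : ℕ → Ω → ℝ) (hXmeas : ∀ i, Measurable (X i))
    {S : ℝ → ℝ} {α : ℝ} (H : RV S α)
    (hS : ∀ i, ∀ x : ℝ, 0 < x → (μ {ω | x < X i ω}).toReal = S x)
    (n : ℕ) (hn : 1 ≤ n) (b : ℝ) (hb : 0 < b) :
    (μ {ω | (∑ i ∈ Finset.range n, if b < X i ω then (1:ℝ) else 0) ≤ n * S b / 2}).toReal
      ≤ 4 * (n * S b + ∑ i ∈ Finset.range n, ∑ j ∈ Finset.range n,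
          if i = j then 0
          else cov μ (fun ω => if b < X i ω then (1 : ℝ) else 0)
            (fun ω => if b < X j ω then (1 : ℝ) else 0)) / (n * S b) ^ 2 := by
  have hSb := H.pos b hb
  have hn' : (0:ℝ) < n := by positivity
  refine cheb μ n (fun i ω => if b < X i ω then (1:ℝ) else 0) (fun i => ind_meas (hXmeas i) b)
    (B := 1) (fun i ω => by split_ifs <;> norm_num)
    (fun i ω => by split_ifs <;> norm_num) (by positivity) ?_ ?_
  · simp_rw [integral_ind μ (hXmeas _), hS _ b hb]
    simp
  · have : ∀ i ω, (if b < X i ω then (1:ℝ) else 0) ^ 2 = if b < X i ω then (1:ℝ) else 0 := by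
      intro i ω; split_ifs <;> norm_num
    simp_rw [this, integral_ind μ (hXmeas _), hS _ b hb]
    simp

lemma num_upper (n : ℕ) (x : ℕ → ℝ) (hx : ∀ i, 0 ≤ x i) {h M : ℝ} (hh : 1 ≤ h) (hM : 0 ≤ M) :
    ∑ i ∈ Finset.range n, max (x i - M) 0 ^ h ≤ (∑ i ∈ Finset.range n, x i) ^ h := by
  have h1 : ∑ i ∈ Finset.range n, max (x i - M) 0 ^ h ≤ ∑ i ∈ Finset.range n, x i ^ h :=
    Finset.sum_le_sum fun i _ => Real.rpow_le_rpow (le_max_right _ _)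
      (max_le (by linarith) (hx i)) (by linarith)
  refine h1.trans ?_
  clear h1
  induction n with
  | zero => simp [Real.zero_rpow (by linarith : h ≠ 0)]
  | succ n ih =>
    rw [Finset.sum_range_succ, Finset.sum_range_succ]
    have := Real.add_rpow_le_rpow_add (Finset.sum_nonneg fun i (_ : i ∈ Finset.range n) => hx i)
      (hx n) hh
    linarith

lemma num_lower (n : ℕ) (x : ℕ → ℝ) (hx : ∀ i, 0 ≤ x i) {h M : ℝ} (hh : 1 ≤ h) (hM : 0 ≤ M) :
    ∑ i ∈ Finset.range n, x i ^ h ≤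
      2 ^ h * (∑ i ∈ Finset.range n, max (x i - M) 0 ^ h + n * M ^ h) := by
  have h1 : ∀ i ∈ Finset.range n, x i ^ h ≤ 2 ^ h * (max (x i - M) 0 ^ h + M ^ h) := by
    intro i _
    set y := max (x i - M) 0 with hy
    have hy0 : 0 ≤ y := le_max_right _ _
    have hy1 : x i - M ≤ y := le_max_left _ _
    have a : 0 ≤ y ^ h := by positivity
    have b : 0 ≤ M ^ h := by positivity
    rcases le_total y M with hl | hl
    · calc x i ^ h ≤ (2 * M) ^ h := Real.rpow_le_rpow (hx i) (by linarith) (by linarith)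
        _ = 2 ^ h * M ^ h := Real.mul_rpow (by norm_num) hM
        _ ≤ _ := by gcongr; linarith
    · calc x i ^ h ≤ (2 * y) ^ h := Real.rpow_le_rpow (hx i) (by linarith) (by linarith)
        _ = 2 ^ h * y ^ h := Real.mul_rpow (by norm_num) hy0
        _ ≤ _ := by gcongr; linarith
  refine (Finset.sum_le_sum h1).trans (le_of_eq ?_)
  rw [← Finset.mul_sum, Finset.sum_add_distrib]
  simp

lemma pw {Ω : Type*} (X : ℕ → Ω → ℝ) (hXnn : ∀ i ω, 0 ≤ X i ω) (n : ℕ) (hn : 1 ≤ n) (ω : Ω)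
    (h b bt c v κ1 κ2 Sb Sbt : ℝ) (hh : 1 < h) (hb : 0 < b) (hbt : 0 < bt) (hc : 0 < c)
    (hv : 0 < v) (hκ1 : 0 < κ1) (hκ2 : 0 < κ2) (hSb : 0 < Sb) (hSbt : 0 < Sbt)
    (g1 : sampleMoment X 1 n ω ≤ bt)
    (g2 : κ1 * (v ^ (1:ℝ) * c) < ∑ i ∈ Finset.range n, X i ω ^ (1:ℝ))
    (g3 : κ2 * (v ^ h * c) < ∑ i ∈ Finset.range n, X i ω ^ h)
    (g4 : (∑ i ∈ Finset.range n, if b < X i ω then (1:ℝ) else 0) < c * (n * Sb))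
    (g5 : n * Sbt / 2 < ∑ i ∈ Finset.range n, if bt < X i ω then (1:ℝ) else 0)
    (hbM : Real.log b ≤ Real.log κ1 + Real.log v + Real.log c - Real.log n)
    (hbig : Real.log n + h * Real.log bt ≤
      Real.log κ2 + h * Real.log v + Real.log c - (h + 1) * Real.log 2) :
    ∃ Y W : ℝ, Real.log (localUpperMoment X h n ω) = Y - W ∧
      Real.log (sampleMoment X 1 n ω) ≤ Real.log bt ∧
      Real.log κ1 + Real.log v + Real.log c - Real.log n ≤ Real.log (sampleMoment X 1 n ω) ∧
      W ≤ Real.log c + Real.log n + Real.log Sb ∧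
      Real.log n + Real.log Sbt - Real.log 2 ≤ W ∧
      Y ≤ h * (Real.log n + Real.log (sampleMoment X 1 n ω)) ∧
      h * Real.log v + Real.log c + Real.log κ2 - (h + 1) * Real.log 2 ≤ Y := by
  have hn' : (0:ℝ) < n := by positivity
  have hsum : ∑ i ∈ Finset.range n, X i ω ^ (1:ℝ) = n * sampleMoment X 1 n ω := by
    rw [sampleMoment, mul_inv_cancel_left₀ hn'.ne']
  have hsum' : ∑ i ∈ Finset.range n, X i ω = n * sampleMoment X 1 n ω := by
    rw [← hsum]; simp
  set M := sampleMoment X 1 n ω with hM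
  rw [hsum, Real.rpow_one] at g2
  have hM0 : 0 < M := by
    have : 0 < n * M := lt_trans (by positivity) g2
    exact (mul_pos_iff_of_pos_left hn').1 this
  have z1 : Real.log M ≤ Real.log bt := Real.log_le_log hM0 g1
  have z2 : Real.log κ1 + Real.log v + Real.log c - Real.log n ≤ Real.log M := by
    have := Real.log_le_log (by positivity) g2.le
    rw [Real.log_mul hκ1.ne' (by positivity), Real.log_mul hv.ne' hc.ne',
      Real.log_mul hn'.ne' hM0.ne'] at this
    linarith
  have hbM' : b ≤ M := (Real.log_le_log_iff hb hM0).1 (hbM.trans z2)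
  have n1 : Nplus X n ω ≤ ∑ i ∈ Finset.range n, if b < X i ω then (1:ℝ) else 0 := by
    refine Finset.sum_le_sum fun i _ => ?_
    rw [← hM]
    split_ifs with a1 a2 a2
    · exact le_rfl
    · exact absurd (lt_of_le_of_lt hbM' a1) a2
    · norm_num
    · exact le_rfl
  have n2 : (∑ i ∈ Finset.range n, if bt < X i ω then (1:ℝ) else 0) ≤ Nplus X n ω := by
    refine Finset.sum_le_sum fun i _ => ?_
    rw [← hM]
    split_ifs with a1 a2 a2
    · exact le_rfl
    · exact absurd (lt_of_le_of_lt g1 a1) a2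
    · norm_num
    · exact le_rfl
  have hN0 : 0 < Nplus X n ω := lt_of_lt_of_le (lt_trans (by positivity) g5) n2
  set Num := ∑ i ∈ Finset.range n, max (X i ω - M) 0 ^ h with hNum
  have u1 : Num ≤ (n * M) ^ h := by
    rw [← hsum']; exact num_upper n (fun i => X i ω) (fun i => hXnn i ω) hh.le hM0.le
  have u2 := num_lower n (fun i => X i ω) (fun i => hXnn i ω) hh.le hM0.le
  change _ ≤ 2 ^ h * (Num + n * M ^ h) at u2
  have hMh : 0 < M ^ h := by positivity
  have u3 : n * M ^ h ≤ κ2 * (v ^ h * c) / 2 ^ (h + 1) := by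
    rw [← Real.log_le_log_iff (by positivity) (by positivity),
      Real.log_mul hn'.ne' hMh.ne', Real.log_div (by positivity) (by positivity),
      Real.log_mul hκ2.ne' (by positivity), Real.log_mul (by positivity) hc.ne',
      Real.log_rpow hM0, Real.log_rpow hv, Real.log_rpow (by norm_num)]
    have : h * Real.log M ≤ h * Real.log bt := mul_le_mul_of_nonneg_left z1 (by linarith)
    linarith
  have u4 : κ2 * (v ^ h * c) / 2 ^ (h + 1) ≤ Num := by
    have e : (2:ℝ) ^ (h+1) = 2 ^ h * 2 := by rw [Real.rpow_add (by norm_num), Real.rpow_one]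
    have p2 : (0:ℝ) < 2 ^ h := by positivity
    have : 2 ^ h * (2 * (κ2 * (v ^ h * c) / 2 ^ (h + 1))) = κ2 * (v ^ h * c) := by
      rw [e]; field_simp
    have w : 2 ^ h * (2 * (κ2 * (v ^ h * c) / 2 ^ (h + 1))) ≤ 2 ^ h * (Num + n * M ^ h) := by
      rw [this]; exact g3.le.trans u2
    have := le_of_mul_le_mul_left w p2
    linarith
  have hNum0 : 0 < Num := lt_of_lt_of_le (by positivity) u4
  refine ⟨Real.log Num, Real.log (Nplus X n ω), ?_, z1, z2, ?_, ?_, ?_, ?_⟩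
  · rw [localUpperMoment, ← hM, ← hNum, Real.log_mul (inv_ne_zero hN0.ne') hNum0.ne',
      Real.log_inv]; ring
  · have := Real.log_le_log hN0 (n1.trans g4.le)
    rw [Real.log_mul hc.ne' (by positivity), Real.log_mul hn'.ne' hSb.ne'] at this
    linarith
  · have := Real.log_le_log (by positivity) (g5.le.trans n2)
    rw [Real.log_div (by positivity) (by norm_num), Real.log_mul hn'.ne' hSbt.ne'] at this
    linarith
  · have := Real.log_le_log hNum0 u1
    rwa [Real.log_rpow (by positivity), Real.log_mul hn'.ne' hM0.ne'] at this
  · have := Real.log_le_log (by positivity) u4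
    rw [Real.log_div (by positivity) (by positivity),
      Real.log_mul hκ2.ne' (by positivity), Real.log_mul (by positivity) hc.ne',
      Real.log_rpow hv, Real.log_rpow (by norm_num)] at this
    linarith

lemma union5 {Ω : Type*} [MeasurableSpace Ω] (μ : Measure Ω) [IsProbabilityMeasure μ]
    (s a b c d e : Set Ω) (h : ∀ ω, ω ∉ a → ω ∉ b → ω ∉ c → ω ∉ d → ω ∉ e → ω ∉ s) :
    (μ s).toReal ≤ (μ a).toReal + (μ b).toReal + (μ c).toReal + (μ d).toReal + (μ e).toReal := by
  have hsub : s ⊆ (((a ∪ b) ∪ c) ∪ d) ∪ e := by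
    intro ω hω
    by_contra hn
    simp only [Set.mem_union, not_or] at hn
    exact h ω hn.1.1.1.1 hn.1.1.1.2 hn.1.1.2 hn.1.2 hn.2 hω
  have h0 := measureReal_mono (μ := μ) hsub
  have h1 := measureReal_union_le (μ := μ) (((a ∪ b) ∪ c) ∪ d) e
  have h2 := measureReal_union_le (μ := μ) ((a ∪ b) ∪ c) d
  have h3 := measureReal_union_le (μ := μ) (a ∪ b) c
  have h4 := measureReal_union_le (μ := μ) a b
  simp only [Measure.real] at *
  linarith

set_option maxHeartbeats 4000000 in
/-- **Theorem (h-th local central upper moments).** -/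
theorem local_central_upper_moments
    {Ω : Type*} [MeasurableSpace Ω] (μ : Measure Ω) [IsProbabilityMeasure μ]
    (X : ℕ → Ω → ℝ) (hXmeas : ∀ i, Measurable (X i)) (hXnn : ∀ i ω, 0 ≤ X i ω)
    (α : ℝ) (hα : 0 < α) (hα1 : α < 1)
    (l : ℝ → ℝ) (hlpos : ∀ x : ℝ, 0 < x → 0 < l x) (hl : SlowlyVarying l)
    (hsurv : ∀ i, ∀ x : ℝ, 0 < x → (μ {ω | x < X i ω}).toReal = x ^ (-α) * l x)
    (c : ℕ → ℝ) (hc : ∀ n, 0 < c n) (hctop : Tendsto c atTop atTop)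
    (hncmono : Monotone fun n : ℕ => (n : ℝ) * c n)
    (hnctop : Tendsto (fun n : ℕ => (n : ℝ) * c n) atTop atTop)
    (hclog : Tendsto (fun n : ℕ => Real.log (c n) / Real.log n) atTop (nhds 0))
    (t : ℕ → ℝ) (htpos : ∀ n, 0 < t n)
    (ht : Tendsto (fun n : ℕ => (n : ℝ) * c n * l (t n) / t n ^ α) atTop (nhds 1))
    (v : ℕ → ℝ) (hvpos : ∀ n, 0 < v n)
    (hv : Tendsto (fun n : ℕ => (n : ℝ) * l (v n) / (v n ^ α * c n)) atTop (nhds 1))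
    (δ' : ℝ) (hδ' : 2 * (1 / α - 1) < δ')
    (b bt : ℕ → ℝ)
    (hb : ∀ n, b n = dOne μ X t n / c n ^ (2 * δ'))
    (hbt : ∀ n, bt n = dOne μ X t n * c n)
    (h : ℝ) (hh : 1 < h)
    (hA1 : ConditionA μ X v c 1) (hAh : ConditionA μ X v c h)
    (hcovind : Tendsto (fun n =>
        (∑ i ∈ Finset.range n, ∑ j ∈ Finset.range n,
          if i = j then 0
          else cov μ (fun ω => if bt n < X i ω then (1 : ℝ) else 0)
            (fun ω => if bt n < X j ω then (1 : ℝ) else 0)) /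
          ((n : ℝ) ^ (2 * α) * (l (bt n) / (l (t n) * c n)) ^ 2))
      atTop (nhds 0)) :
    IsOp μ (fun n ω =>
        Real.log (localUpperMoment X h n ω) / Real.log (sampleMoment X 1 n ω) -
          (h - α ^ 2) / (1 - α))
      (fun n => (Real.log (c n) + |Real.log (l (t n))| + |Real.log (l (b n))| +
        |Real.log (l (bt n))|) / Real.log n) := by
  have hδp : 0 ≤ δ' := by
    have : 1 ≤ 1 / α := by rw [le_div_iff₀ hα]; linarith
    linarith
  obtain ⟨S, hSdef⟩ : ∃ S : ℝ → ℝ, ∀ x, S x = x ^ (-α) * l x := ⟨_, fun _ => rfl⟩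
  have hS : ∀ i, ∀ x : ℝ, 0 < x → (μ {ω | x < X i ω}).toReal = S x := by
    intro i x hx; rw [hSdef]; exact hsurv i x hx
  have H : RV S α := by
    refine ⟨?_, ?_, ?_⟩
    · intro x y hx hxy
      rw [← hS 0 x hx, ← hS 0 y (by linarith)]
      exact measureReal_mono (μ := μ) (fun ω hω => lt_of_le_of_lt hxy hω)
    · intro x hx
      rw [hSdef]
      have := hlpos x hx
      positivity
    · have h1 := (hl 2 (by norm_num)).const_mul ((2:ℝ) ^ (-α))
      rw [mul_one] at h1
      refine h1.congr' ?_
      filter_upwards [eventually_gt_atTop 0] with x hx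
      rw [hSdef, hSdef, Real.mul_rpow (by norm_num) hx.le]
      have := Real.rpow_pos_of_pos hx (-α)
      have := hlpos x hx
      field_simp
  have hlogS : ∀ x, 0 < x → Real.log (S x) = -α * Real.log x + Real.log (l x) := by
    intro x hx
    rw [hSdef, Real.log_mul (by positivity) (hlpos x hx).ne', Real.log_rpow hx]
  obtain ⟨C1, x1, hC1, hx1, hlow⟩ := moment_lower H hα one_pos
  obtain ⟨C2, x2, hC2, hx2, hup⟩ := moment_upper H hα hα1
  have hdeq : ∀ n, dOne μ X t n = ∫ ω, trunc (X 0) (t n) ω ^ (1:ℝ) ∂μ := by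
    intro n; simp [dOne]
  obtain ⟨htT, hvT, K, hK, hev⟩ := asymp hα hα1 H (fun x _ => hSdef x) c hc hctop hclog t htpos ht
    v hvpos hv (dOne μ X t) C1 C2 (max x1 x2) hC1 hC2 (by
      intro n hn
      have e1 := hlow μ (X 0) (hXmeas 0) (hXnn 0) (hS 0) (t n) ((le_max_left _ _).trans hn)
      have e2 := hup μ (X 0) (hXmeas 0) (hXnn 0) (hS 0) (t n) ((le_max_right _ _).trans hn)
      rw [← hdeq, Real.rpow_one] at e1 e2
      exact ⟨e1, e2⟩)
  have hlc : Tendsto (fun n : ℕ => Real.log (c n)) atTop atTop :=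
    Real.tendsto_log_atTop.comp hctop
  -- event 1
  have E1 := event1 μ X hXmeas hXnn H hα1 hS c hc hctop t htpos htT (dOne μ X t)
    (Real.exp 1) (C2 / C1) (by positivity) (by
      filter_upwards [hev] with n hn
      obtain ⟨a1, a2, a3, a4, a5, -⟩ := hn
      have hcn := hc n
      have hn0 : (0:ℝ) < n := by positivity
      have hSt := H.pos _ (htpos n)
      rw [le_div_iff₀ hcn, ← Real.log_le_iff_le_exp (by positivity),
        Real.log_mul (by positivity) hcn.ne', Real.log_mul hn0.ne' hSt.ne']
      have := (abs_le.1 a5).2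
      linarith) (by
      filter_upwards [hev, htT.eventually_ge_atTop x1, htT.eventually_ge_atTop x2] with n hn g1 g2
      refine ⟨hn.2.2.2.1, fun i => ?_⟩
      have e1 := hlow μ (X 0) (hXmeas 0) (hXnn 0) (hS 0) (t n) g1
      have e2 := hup μ (X i) (hXmeas i) (hXnn i) (hS i) (t n) g2
      rw [← hdeq] at e1
      refine e2.trans ?_
      rw [div_mul_eq_mul_div, le_div_iff₀ hC1]
      nlinarith)
  -- events 2 and 3
  have hAv : ∀ᶠ n : ℕ in atTop, Real.exp (-1) * c n ≤ (n:ℝ) * S (v n) ∧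
      (n:ℝ) * S (v n) ≤ Real.exp 1 * c n := by
    filter_upwards [hev] with n hn
    obtain ⟨a1, a2, a3, a4, a5, a6, -⟩ := hn
    have hcn := hc n
    have hn0 : (0:ℝ) < n := by positivity
    have hSv := H.pos _ (hvpos n)
    have := abs_le.1 a6
    constructor
    · rw [← Real.log_le_log_iff (by positivity) (by positivity),
        Real.log_mul (by positivity) hcn.ne', Real.log_mul hn0.ne' hSv.ne', Real.log_exp]
      linarith
    · rw [← Real.log_le_log_iff (by positivity) (by positivity),
        Real.log_mul (by positivity) hSv.ne', Real.log_mul (by positivity) hcn.ne', Real.log_exp]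
      linarith
  obtain ⟨κ1, hκ1, E2⟩ := event23 μ X hXmeas hXnn H hα hα1 hS c hc hctop v hvpos hvT
    (Real.exp (-1)) (Real.exp 1) (Real.exp_pos _) hAv 1 le_rfl hA1
  obtain ⟨κ2, hκ2, E3⟩ := event23 μ X hXmeas hXnn H hα hα1 hS c hc hctop v hvpos hvT
    (Real.exp (-1)) (Real.exp 1) (Real.exp_pos _) hAv h hh.le hAh
  -- constants
  obtain ⟨ρ, hρ⟩ : ∃ ρ, ρ = 4 / α - 2 := ⟨_, rfl⟩
  have hρp : 0 ≤ ρ := by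
    have : 4 ≤ 4 / α := by rw [le_div_iff₀ hα]; linarith
    linarith
  have hρδ : 0 < 2 + 2 * δ' - ρ := by
    have : 4 / α = 4 * (1 / α) := by ring
    linarith
  have hl2 : 0 < Real.log 2 := Real.log_pos (by norm_num)
  have hl2' : Real.log 2 ≤ 1 := by
    have := Real.log_le_sub_one_of_pos (show (0:ℝ) < 2 by norm_num); linarith
  obtain ⟨K', hK'⟩ : ∃ K', K' = K + |Real.log κ1| + |Real.log κ2| + (h + 1) * Real.log 2 :=
    ⟨_, rfl⟩
  have hhl2 : 0 ≤ (h + 1) * Real.log 2 := by positivity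
  have ab1 := neg_abs_le (Real.log κ1)
  have ab2 := neg_abs_le (Real.log κ2)
  have ab3 := abs_nonneg (Real.log κ1)
  have ab4 := abs_nonneg (Real.log κ2)
  have hK'0 : 0 ≤ K' := by linarith
  obtain ⟨σ, hσ⟩ : ∃ σ, σ = 2 / (1 + α) := ⟨_, rfl⟩
  have hσ1 : 1 < σ := by rw [hσ, lt_div_iff₀ (by linarith)]; linarith
  have hσ2 : σ * ((1 + α) / 2) = 1 := by rw [hσ]; field_simp
  obtain ⟨C, hC, halg⟩ := log_algebra α h δ' K' ρ ((σ - 1) / 2) hα hα1 hh hδp hK'0 hρp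
    (by linarith)
  -- combined deterministic facts
  have hdet : ∀ᶠ n : ℕ in atTop, 0 < b n ∧ 0 < bt n ∧
      Real.log (b n) = Real.log (dOne μ X t n) - 2 * δ' * Real.log (c n) ∧
      Real.log (bt n) = Real.log (dOne μ X t n) + Real.log (c n) ∧ bt n < v n := by
    filter_upwards [hev, ev_small hclog ρ (2 * K + 1) 1 one_pos] with n hn s1
    obtain ⟨a1, a2, a3, a4, a5, a6, a7, a8, a9, a10⟩ := hn
    have hcn := hc n
    have hbtp : 0 < bt n := by rw [hbt]; positivity
    have e2 : Real.log (bt n) = Real.log (dOne μ X t n) + Real.log (c n) := by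
      rw [hbt, Real.log_mul a4.ne' hcn.ne']
    refine ⟨by rw [hb]; positivity, hbtp, ?_, e2, ?_⟩
    · rw [hb, Real.log_div a4.ne' (by positivity), Real.log_rpow hcn]
    · rw [← Real.log_lt_log_iff hbtp (hvpos n), e2]
      rw [← hρ] at a9
      have := (abs_le.1 a7).2
      linarith
  -- event 4
  have E4 : Tendsto (fun n : ℕ => (μ {ω | c n * (n * S (b n)) ≤
      ∑ i ∈ Finset.range n, if b n < X i ω then (1:ℝ) else 0}).toReal) atTop (nhds 0) := by
    refine squeeze_zero' (Eventually.of_forall fun n => ENNReal.toReal_nonneg) ?_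
      (hctop.const_div_atTop 1)
    filter_upwards [hdet, eventually_ge_atTop 1] with n hn h1
    exact event4 μ X hXmeas H hS n h1 (b n) (c n) hn.1 (hc n)
  -- event 5
  have E5 : Tendsto (fun n : ℕ => (μ {ω | (∑ i ∈ Finset.range n, if bt n < X i ω then (1:ℝ) else 0)
      ≤ n * S (bt n) / 2}).toReal) atTop (nhds 0) := by
    have hlim := ((hctop.const_div_atTop (4 * Real.exp 1)).add
      (hcovind.abs.const_mul (4 * Real.exp (2 * (1 + K)))))
    rw [abs_zero, mul_zero, add_zero] at hlim
    refine squeeze_zero' (Eventually.of_forall fun n => ENNReal.toReal_nonneg) ?_ hlim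
    filter_upwards [hdet, hev, hAv] with n hn hn2 hn3
    obtain ⟨q1, q2, q3, q4, q5⟩ := hn
    obtain ⟨a1, a2, a3, a4, a5, a6, a7, a8, a9, a10⟩ := hn2
    refine (event5 μ X hXmeas H hS n (by omega) (bt n) q2).trans ?_
    set R := ∑ i ∈ Finset.range n, ∑ j ∈ Finset.range n,
          if i = j then 0
          else cov μ (fun ω => if bt n < X i ω then (1 : ℝ) else 0)
            (fun ω => if bt n < X j ω then (1 : ℝ) else 0) with hR
    have hcn := hc n
    have hn0 : (0:ℝ) < n := by positivity
    have hSbt := H.pos _ q2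
    have hlt := hlpos _ (htpos n)
    have hlbt := hlpos _ q2
    set m := (n:ℝ) * S (bt n) with hm
    have hmp : 0 < m := by positivity
    have hmc : Real.exp (-1) * c n ≤ m := hn3.1.trans
      (mul_le_mul_of_nonneg_left (H.anti _ _ q2 q5.le) hn0.le)
    set Dn := (n : ℝ) ^ (2 * α) * (l (bt n) / (l (t n) * c n)) ^ 2 with hDn
    have hDp : 0 < Dn := by positivity
    have hDm : Dn ≤ Real.exp (2 * (1 + K)) * m ^ 2 := by
      rw [← Real.log_le_log_iff hDp (by positivity), hDn, hm,
        Real.log_mul (by positivity) (by positivity), Real.log_mul (by positivity) (by positivity),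
        Real.log_pow, Real.log_pow, Real.log_rpow hn0, Real.log_exp,
        Real.log_div hlbt.ne' (by positivity), Real.log_mul hlt.ne' hcn.ne',
        Real.log_mul hn0.ne' hSbt.ne', hlogS _ q2, q4]
      rw [hlogS _ (htpos n)] at a5
      have b5 := abs_le.1 a5
      have b7 := (abs_le.1 a7).2
      have : α * (Real.log (dOne μ X t n) + Real.log (c n))
          ≤ α * (Real.log (t n) - Real.log n + K) :=
        mul_le_mul_of_nonneg_left (by linarith) hα.le
      have : α * K ≤ K := mul_le_of_le_one_left hK hα1.le
      push_cast
      linarith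
    have t1 : 1 / m ≤ Real.exp 1 / c n := by
      rw [div_le_div_iff₀ hmp hcn]
      have : Real.exp 1 * (Real.exp (-1) * c n) ≤ Real.exp 1 * m := by gcongr
      rw [← mul_assoc, ← Real.exp_add] at this
      simpa using this
    have t2 : R / m ^ 2 ≤ Real.exp (2 * (1 + K)) * |R / Dn| := by
      calc R / m ^ 2 ≤ |R| / m ^ 2 := by gcongr; exact le_abs_self R
        _ ≤ Real.exp (2 * (1 + K)) * (|R| / Dn) := by
            rw [← mul_div_assoc, div_le_div_iff₀ (by positivity) hDp]
            have := mul_le_mul_of_nonneg_left hDm (abs_nonneg R)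
            linarith
        _ = _ := by rw [abs_div, abs_of_pos hDp]
    have e : 4 * (m + R) / m ^ 2 = 4 * (1 / m) + 4 * (R / m ^ 2) := by field_simp
    have e' : 4 * Real.exp 1 / c n = 4 * (Real.exp 1 / c n) := by ring
    rw [e, e']
    linarith
  -- conclusion
  intro ε hε
  refine ⟨C, hC, ?_⟩
  have Esum := (((E1.add E2).add E3).add E4).add E5
  simp only [add_zero] at Esum
  filter_upwards [Esum.eventually (gt_mem_nhds hε), hdet, hev,
    ev_small hclog σ (σ * K + K') ((σ - 1) / 2) (by linarith),
    hlc.eventually_ge_atTop ((2 * K + K') / (2 + 2 * δ' - ρ)),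
    ev_small hclog (h * ρ) (2 * h * K + K') (h - 1) (by linarith)] with n hsum q hn s1 s2 s3
  refine lt_of_le_of_lt (union5 μ _ _ _ _ _ _ ?_) hsum
  intro ω g1 g2 g3 g4 g5
  simp only [Set.mem_ofPred_eq, not_lt, not_le] at g1 g2 g3 g4 g5 ⊢
  obtain ⟨q1, q2, q3, q4, q5⟩ := q
  obtain ⟨a1, a2, a3, a4, a5, a6, a7, a8, a9, a10⟩ := hn
  rw [div_le_iff₀ hρδ] at s2
  rw [← hρ] at a9
  have b7 := abs_le.1 a7
  have hcn := hc n
  rw [← hbt] at g1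
  have hVlow : σ * (Real.log n - Real.log (c n) - K) ≤ Real.log (v n) := by
    have := mul_le_mul_of_nonneg_left a10 (show 0 ≤ σ by linarith)
    rwa [← mul_assoc, hσ2, one_mul] at this
  have hbtV : h * Real.log (bt n) ≤ h * (Real.log (v n) + ρ * Real.log (c n) + 2 * K - Real.log n) :=
    mul_le_mul_of_nonneg_left (by rw [q4]; linarith) (by linarith)
  obtain ⟨Y, W, r0, r1, r2, r3, r4, r5, r6⟩ := pw X hXnn n (by omega) ω h (b n) (bt n) (c n) (v n)
    κ1 κ2 (S (b n)) (S (bt n)) hh q1 q2 hcn (hvpos n) hκ1 hκ2 (H.pos _ q1) (H.pos _ q2)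
    g1 g2 g3 g4 g5 (by rw [q3]; linarith) (by linarith)
  rw [r0]
  rw [hlogS _ q1, q3] at r3
  rw [hlogS _ q2, q4] at r4
  rw [q4] at r1
  rw [hlogS _ (htpos n)] at a5
  refine halg (Real.log n) (Real.log (c n)) (Real.log (t n)) (Real.log (v n))
    (Real.log (dOne μ X t n)) (Real.log (l (t n))) (Real.log (l (b n))) (Real.log (l (bt n)))
    Y W (Real.log (sampleMoment X 1 n ω)) a3 a2 ?_ ?_ a8 ?_ ?_ ?_ ?_ ?_ r5 ?_ ?_
  · convert a5 using 2; ring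
  · exact a7.trans (by linarith)
  · linarith
  · linarith
  · linarith
  · linarith
  · linarith
  · linarith
  · linarith
end
end

section
/- For each n, let G_n be a graph on vertices v₁,…,v_n with graph distance d (the length of a shortest path, with d(vᵢ,vⱼ) = ∞ if no path exists). On a probability space, let X₁,…,X_n be nonnegative random variables with common survival function P(Xᵢ > x) = x^{-α} l(x) for all x > 0, where α > 0 and l is slowly varying at infinity. Fix p > α and assume: (1) there is a nonnegative integer M₀, independent of n, such that Cov(X̌ᵢ^p, X̌ⱼ^p) = 0 whenever d(vᵢ, vⱼ) > M₀; (2) there is a positive integer K, independent of n, such that every vertex of G_n has degree at most K. Then ∑_{1≤i,j≤n, i≠j} Cov(X̌ᵢ^p, X̌ⱼ^p) / (v_n^{2p}·c_n²) → 0 as n → ∞. -/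
open MeasureTheory Filter

noncomputable section

theorem aux_ball (V : Type) [Fintype V] [DecidableEq V] (G : SimpleGraph V) [DecidableRel G.Adj]
    (K : ℕ) (hdeg : ∀ i, G.degree i ≤ K) (M : ℕ) :
    ∀ i : V, ∃ B : Finset V, B.card ≤ (1 + K) ^ M ∧
      ∀ j, ∀ w : G.Walk i j, w.length ≤ M → j ∈ B := by
  induction M with
  | zero =>
    intro i
    refine ⟨{i}, by simp, ?_⟩
    intro j w hw
    have := SimpleGraph.Walk.eq_of_length_eq_zero (p := w) (by omega)
    simp [this]
  | succ M ih =>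
    intro i
    choose B hB hB2 using ih
    refine ⟨B i ∪ (G.neighborFinset i).biUnion B, ?_, ?_⟩
    · have h1 : ((G.neighborFinset i).biUnion B).card ≤ K * (1 + K) ^ M := by
        refine (Finset.card_biUnion_le_card_mul _ _ ((1 + K) ^ M) (fun a _ => hB a)).trans ?_
        rw [SimpleGraph.card_neighborFinset_eq_degree]
        exact Nat.mul_le_mul_right _ (hdeg i)
      have h2 := Finset.card_union_le (B i) ((G.neighborFinset i).biUnion B)
      have h3 := hB i
      rw [pow_succ]
      nlinarith
    · intro j w hw
      cases w with
      | nil => exact Finset.mem_union_left _ (hB2 i i SimpleGraph.Walk.nil (by simp))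
      | cons h w' =>
        refine Finset.mem_union_right _ (Finset.mem_biUnion.2 ⟨_, ?_, hB2 _ _ w' ?_⟩)
        · simpa using h
        · simpa using hw

theorem aux_karamata (S : ℝ → ℝ) (hSpos : ∀ x, 0 < x → 0 < S x)
    (hSanti : ∀ x y, 0 < x → x ≤ y → S y ≤ S x) (p R x0 : ℝ) (hp : 0 < p) (hR0 : 0 < R)
    (hR : R < 2 ^ p) (hx0 : 0 < x0) (hS : ∀ x, x0 ≤ x → S (x / 2) ≤ R * S x) :
    ∃ D x1 : ℝ, 0 < D ∧ 0 < x1 ∧ ∀ F : ℝ → ℝ, (∀ x, 0 < x → F x ≤ x ^ p) →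
      (∀ x, 0 < x → F x ≤ F (x / 2) + x ^ p * S (x / 4)) →
      ∀ x, x1 ≤ x → F x ≤ D * (x ^ p * S x) := by
  have h2p : (0:ℝ) < 2 ^ p := by positivity
  set q := R / 2 ^ p with hq
  have hq1 : q < 1 := by rw [hq, div_lt_one h2p]; exact hR
  have hq0 : 0 < q := by positivity
  set x1 := 2 * x0 with hx1
  have hx1p : 0 < x1 := by positivity
  set D := max (1 / S (2 * x1)) (R ^ 2 / (1 - q)) with hD
  have hDpos : 0 < D := lt_max_of_lt_left (by have := hSpos (2*x1) (by positivity); positivity)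
  have hD2 : R ^ 2 ≤ D * (1 - q) := by
    rw [← div_le_iff₀ (by linarith)]; exact le_max_right _ _
  refine ⟨D, x1, hDpos, hx1p, ?_⟩
  intro F hF1 hF2
  have base : ∀ x, x1 ≤ x → x ≤ 2 * x1 → F x ≤ D * (x ^ p * S x) := by
    intro x hx hx'
    have hxp : 0 < x := by linarith
    have h1 := hF1 x hxp
    have h2 := hSanti x (2*x1) hxp hx'
    have h3 := hSpos (2*x1) (by positivity)
    have h4 : 1 ≤ D * S x := by
      have : 1 / S (2*x1) * S (2*x1) ≤ D * S x :=
        mul_le_mul (le_max_left _ _) h2 h3.le hDpos.le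
      rwa [one_div, inv_mul_cancel₀ h3.ne'] at this
    have h5 : 0 < x ^ p := by positivity
    nlinarith
  have key : ∀ k : ℕ, ∀ x, x1 ≤ x → x ≤ 2 ^ (k+1) * x1 → F x ≤ D * (x ^ p * S x) := by
    intro k
    induction k with
    | zero => intro x h h'; exact base x h (by simpa using h')
    | succ k ih =>
      intro x hx hx'
      by_cases hle : x ≤ 2 * x1
      · exact base x hx hle
      push Not at hle
      have hxp : 0 < x := by linarith
      have h1 := ih (x/2) (by linarith) (by rw [pow_succ] at hx'; linarith)
      have h2 := hF2 x hxp
      have h3 := hS x (by linarith)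
      have h4 := hS (x/2) (by linarith)
      rw [show x / 2 / 2 = x / 4 by ring] at h4
      have h5 : S (x/4) ≤ R ^ 2 * S x := by nlinarith
      have h6 : (x/2) ^ p = x ^ p / 2 ^ p := Real.div_rpow hxp.le (by norm_num) p
      have hxpp : 0 < x ^ p := by positivity
      have hSx := hSpos x hxp
      have h7 : (x/2)^p * S (x/2) ≤ q * (x ^ p * S x) := by
        rw [h6]
        calc x ^ p / 2 ^ p * S (x/2) ≤ x ^ p / 2 ^ p * (R * S x) := by gcongr
          _ = _ := by rw [hq]; ring
      calc F x ≤ F (x/2) + x ^ p * S (x/4) := h2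
        _ ≤ D * (q * (x ^ p * S x)) + x ^ p * (R ^ 2 * S x) := by
          gcongr
          exact h1.trans (by gcongr)
        _ = (D * q + R ^ 2) * (x ^ p * S x) := by ring
        _ ≤ D * (x ^ p * S x) := by gcongr; linarith
  intro x hx
  obtain ⟨k, hk⟩ := pow_unbounded_of_one_lt (x / x1) (by norm_num : (1:ℝ) < 2)
  refine key k x hx ?_
  rw [div_lt_iff₀ hx1p] at hk
  rw [pow_succ]
  nlinarith [show (0:ℝ) < 2 ^ k * x1 by positivity]

theorem aux_trunc_nonneg {Ω : Type*} (X : Ω → ℝ) (hX : ∀ ω, 0 ≤ X ω) (t : ℝ) (ω : Ω) :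
    0 ≤ trunc X t ω := by
  unfold trunc; split_ifs; exacts [hX ω, le_rfl]

theorem aux_trunc_le {Ω : Type*} (X : Ω → ℝ) (t : ℝ) (ht : 0 < t) (ω : Ω) :
    trunc X t ω ≤ t := by
  unfold trunc; split_ifs with h; exacts [h.le, ht.le]

theorem aux_meas {Ω : Type*} [MeasurableSpace Ω] (X : Ω → ℝ) (hX : Measurable X) (t p : ℝ) :
    Measurable (fun ω => trunc X t ω ^ p) := by
  have : Measurable (trunc X t) :=
    Measurable.ite (measurableSet_lt hX measurable_const) hX measurable_const
  exact this.pow_const p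

theorem aux_integrable {Ω : Type*} [MeasurableSpace Ω] (μ : Measure Ω) [IsProbabilityMeasure μ]
    (X : Ω → ℝ) (hX : Measurable X) (hX0 : ∀ ω, 0 ≤ X ω) (t p : ℝ) (ht : 0 < t) (hp : 0 < p) :
    Integrable (fun ω => trunc X t ω ^ p) μ := by
  refine Integrable.of_bound (aux_meas X hX t p).aestronglyMeasurable (t ^ p)
    (Eventually.of_forall fun ω => ?_)
  have h0 := aux_trunc_nonneg X hX0 t ω
  rw [Real.norm_of_nonneg (by positivity)]
  exact Real.rpow_le_rpow h0 (aux_trunc_le X t ht ω) hp.le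

theorem aux_F1 {Ω : Type*} [MeasurableSpace Ω] (μ : Measure Ω) [IsProbabilityMeasure μ]
    (X : Ω → ℝ) (hX : Measurable X) (hX0 : ∀ ω, 0 ≤ X ω) (t p : ℝ) (ht : 0 < t) (hp : 0 < p) :
    ∫ ω, trunc X t ω ^ p ∂μ ≤ t ^ p := by
  calc ∫ ω, trunc X t ω ^ p ∂μ ≤ ∫ ω, t ^ p ∂μ :=
        integral_mono (aux_integrable μ X hX hX0 t p ht hp) (integrable_const _) (fun ω =>
          Real.rpow_le_rpow (aux_trunc_nonneg X hX0 t ω) (aux_trunc_le X t ht ω) hp.le)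
    _ = t ^ p := by simp

theorem aux_F2 {Ω : Type*} [MeasurableSpace Ω] (μ : Measure Ω) [IsProbabilityMeasure μ]
    (X : Ω → ℝ) (hX : Measurable X) (hX0 : ∀ ω, 0 ≤ X ω) (t p : ℝ) (ht : 0 < t) (hp : 0 < p) :
    ∫ ω, trunc X t ω ^ p ∂μ ≤ ∫ ω, trunc X (t / 2) ω ^ p ∂μ
      + t ^ p * (μ {ω | t / 4 < X ω}).toReal := by
  have hs : MeasurableSet {ω | t / 4 < X ω} := measurableSet_lt measurable_const hX
  have hi : Integrable ({ω | t / 4 < X ω}.indicator (fun _ => t ^ p)) μ :=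
    (integrable_const _).indicator hs
  have e : t ^ p * (μ {ω | t / 4 < X ω}).toReal
      = ∫ ω, {ω | t / 4 < X ω}.indicator (fun _ => t ^ p) ω ∂μ := by
    rw [integral_indicator_const _ hs, smul_eq_mul, mul_comm]; rfl
  have hi2 := aux_integrable μ X hX hX0 (t/2) p (by positivity) hp
  rw [e, ← integral_add hi2 hi]
  refine integral_mono (aux_integrable μ X hX hX0 t p ht hp) (hi2.add hi) (fun ω => ?_)
  have h0 := aux_trunc_nonneg X hX0 (t/2) ω
  by_cases h : X ω < t / 2
  · have h1 : trunc X t ω = trunc X (t/2) ω := by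
      unfold trunc; rw [if_pos h, if_pos (by linarith)]
    have h2 : 0 ≤ {ω | t / 4 < X ω}.indicator (fun _ => t ^ p) ω :=
      Set.indicator_nonneg (fun _ _ => by positivity) _
    simp only [Pi.add_apply, h1]; linarith
  · have h1 : {ω | t / 4 < X ω}.indicator (fun _ => t ^ p) ω = t ^ p :=
      Set.indicator_of_mem (by simp only [Set.mem_setOf_eq]; linarith) _
    have h2 := Real.rpow_le_rpow (aux_trunc_nonneg X hX0 t ω) (aux_trunc_le X t ht ω) hp.le
    have h3 : 0 ≤ trunc X (t/2) ω ^ p := by positivity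
    simp only [Pi.add_apply, h1]; linarith

theorem aux_cov {Ω : Type*} [MeasurableSpace Ω] (μ : Measure Ω) [IsProbabilityMeasure μ]
    (X Y : Ω → ℝ) (hX : Measurable X) (hX0 : ∀ ω, 0 ≤ X ω)
    (hY : Measurable Y) (hY0 : ∀ ω, 0 ≤ Y ω) (t p : ℝ) (ht : 0 < t) (hp : 0 < p) :
    |cov μ (fun ω => trunc X t ω ^ p) (fun ω => trunc Y t ω ^ p)|
      ≤ t ^ p * ∫ ω, trunc Y t ω ^ p ∂μ := by
  have hx0 := fun ω => Real.rpow_nonneg (aux_trunc_nonneg X hX0 t ω) p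
  have hy0 := fun ω => Real.rpow_nonneg (aux_trunc_nonneg Y hY0 t ω) p
  have hx1 := fun ω => Real.rpow_le_rpow (aux_trunc_nonneg X hX0 t ω) (aux_trunc_le X t ht ω) hp.le
  have hiY := aux_integrable μ Y hY hY0 t p ht hp
  have a1 : 0 ≤ ∫ ω, trunc X t ω ^ p * trunc Y t ω ^ p ∂μ :=
    integral_nonneg fun ω => mul_nonneg (hx0 ω) (hy0 ω)
  have a2 : ∫ ω, trunc X t ω ^ p * trunc Y t ω ^ p ∂μ ≤ t ^ p * ∫ ω, trunc Y t ω ^ p ∂μ := by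
    rw [← integral_const_mul]
    exact integral_mono_of_nonneg (Eventually.of_forall fun ω => mul_nonneg (hx0 ω) (hy0 ω))
      (hiY.const_mul _) (Eventually.of_forall fun ω => mul_le_mul_of_nonneg_right (hx1 ω) (hy0 ω))
  have a3 : 0 ≤ ∫ ω, trunc X t ω ^ p ∂μ := integral_nonneg hx0
  have a4 : 0 ≤ ∫ ω, trunc Y t ω ^ p ∂μ := integral_nonneg hy0
  have a5 := aux_F1 μ X hX hX0 t p ht hp
  have a6 := mul_le_mul_of_nonneg_right a5 a4
  have a7 := mul_nonneg a3 a4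
  unfold cov
  rw [abs_le]
  constructor <;> linarith

/-- **Taylor's law covariance condition for network data (Example on a graph).**
For each `n`, `G n` is a graph on `n` vertices.  If the covariance of the truncated
`p`-th powers vanishes whenever the graph distance between the two vertices exceeds a
fixed bound `M₀` (in particular when the vertices are not connected by any path), and all
vertex degrees are bounded by a fixed `K`, then the covariance condition holds. -/
theorem network_covariance_condition
    {Ω : Type*} [MeasurableSpace Ω] (μ : Measure Ω) [IsProbabilityMeasure μ]
    (G : ∀ n : ℕ, SimpleGraph (Fin n)) [∀ n, DecidableRel (G n).Adj]
    (X : ℕ → Ω → ℝ) (hXmeas : ∀ i, Measurable (X i)) (hXnn : ∀ i ω, 0 ≤ X i ω)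
    (α : ℝ) (hα : 0 < α)
    (l : ℝ → ℝ) (hlpos : ∀ x : ℝ, 0 < x → 0 < l x) (hl : SlowlyVarying l)
    (hsurv : ∀ i, ∀ x : ℝ, 0 < x → (μ {ω | x < X i ω}).toReal = x ^ (-α) * l x)
    (c : ℕ → ℝ) (hc : ∀ n, 0 < c n) (hctop : Tendsto c atTop atTop)
    (hncmono : Monotone fun n : ℕ => (n : ℝ) * c n)
    (hnctop : Tendsto (fun n : ℕ => (n : ℝ) * c n) atTop atTop)
    (hclog : Tendsto (fun n : ℕ => Real.log (c n) / Real.log n) atTop (nhds 0))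
    (v : ℕ → ℝ) (hvpos : ∀ n, 0 < v n)
    (hv : Tendsto (fun n : ℕ => (n : ℝ) * l (v n) / (v n ^ α * c n)) atTop (nhds 1))
    (p : ℝ) (hp : α < p)
    (M₀ : ℕ)
    (hcov0 : ∀ n : ℕ, ∀ i j : Fin n,
      (¬ (G n).Reachable i j ∨ M₀ < (G n).dist i j) →
      cov μ (fun ω => trunc (X (i : ℕ)) (v n) ω ^ p)
        (fun ω => trunc (X (j : ℕ)) (v n) ω ^ p) = 0)
    (K : ℕ) (hK : 0 < K)
    (hdeg : ∀ n : ℕ, ∀ i : Fin n, (G n).degree i ≤ K) :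
    Tendsto (fun n =>
      (∑ i : Fin n, ∑ j : Fin n,
        if i = j then 0
        else cov μ (fun ω => trunc (X (i : ℕ)) (v n) ω ^ p)
          (fun ω => trunc (X (j : ℕ)) (v n) ω ^ p)) /
        (v n ^ (2 * p) * c n ^ 2)) atTop (nhds 0) := by
  have hp0 : 0 < p := hα.trans hp
  set S : ℝ → ℝ := fun x => x ^ (-α) * l x with hSdef
  have hSpos : ∀ x, 0 < x → 0 < S x := fun x hx => mul_pos (by positivity) (hlpos x hx)
  have hSanti : ∀ x y, 0 < x → x ≤ y → S y ≤ S x := by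
    intro x y hx hxy
    have h1 := hsurv 0 x hx
    have h2 := hsurv 0 y (hx.trans_le hxy)
    simp only [hSdef]
    rw [← h1, ← h2]
    exact ENNReal.toReal_mono (measure_ne_top _ _)
      (measure_mono fun ω (hω : y < X 0 ω) => lt_of_le_of_lt hxy hω)
  obtain ⟨β, hβ1, hβ2⟩ := exists_between hp
  have hαβ : (2:ℝ) ^ α < 2 ^ β := Real.rpow_lt_rpow_of_exponent_lt (by norm_num) hβ1
  have hβp : (2:ℝ) ^ β < 2 ^ p := Real.rpow_lt_rpow_of_exponent_lt (by norm_num) hβ2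
  have hev : ∀ᶠ x in atTop, S (x / 2) ≤ 2 ^ β * S x := by
    have h1 := (hl (1/2) (by norm_num)).const_mul ((2:ℝ) ^ α)
    rw [mul_one] at h1
    filter_upwards [h1.eventually_lt_const hαβ, eventually_gt_atTop 0] with x hx hx0
    have hlx := hlpos x hx0
    have e : S (x / 2) = (2 ^ α * (l (1 / 2 * x) / l x)) * S x := by
      simp only [hSdef]
      rw [Real.div_rpow hx0.le (by norm_num), Real.rpow_neg (by norm_num : (0:ℝ) ≤ 2),
        show x / 2 = 1 / 2 * x by ring]
      field_simp
    rw [e]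
    exact mul_le_mul_of_nonneg_right hx.le (hSpos x hx0).le
  obtain ⟨x0, hx0⟩ := eventually_atTop.1 hev
  obtain ⟨D, x1, hD, hx1, hkar⟩ := aux_karamata S hSpos hSanti p (2 ^ β) (max x0 1) hp0
    (by positivity) hβp (by positivity) (fun x hx => hx0 x ((le_max_left _ _).trans hx))
  have hF : ∀ i x, x1 ≤ x → ∫ ω, trunc (X i) x ω ^ p ∂μ ≤ D * (x ^ p * S x) := by
    intro i
    refine hkar (fun x => ∫ ω, trunc (X i) x ω ^ p ∂μ) ?_ ?_
    · exact fun x hx => aux_F1 μ _ (hXmeas i) (hXnn i) x p hx hp0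
    · intro x hx
      have := aux_F2 μ _ (hXmeas i) (hXnn i) x p hx hp0
      rwa [hsurv i (x/4) (by positivity)] at this
  -- asymptotics
  have hvS : Tendsto (fun n : ℕ => (n : ℝ) * S (v n) / c n) atTop (nhds 1) := by
    refine hv.congr fun n => ?_
    simp only [hSdef]
    rw [Real.rpow_neg (hvpos n).le]
    have := Real.rpow_pos_of_pos (hvpos n) α
    have := hc n
    field_simp
  have hcn : Tendsto (fun n : ℕ => c n / n) atTop (nhds 0) := by
    have h0 : Tendsto (fun n : ℕ => (n:ℝ) ^ (-(1/2:ℝ))) atTop (nhds 0) :=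
      (tendsto_rpow_neg_atTop (by norm_num : (0:ℝ) < 1/2)).comp tendsto_natCast_atTop_atTop
    refine squeeze_zero' (Eventually.of_forall fun n => by have := hc n; positivity) ?_ h0
    filter_upwards [hclog.eventually_lt_const (by norm_num : (0:ℝ) < 1/2),
      eventually_ge_atTop 2] with n hn hn2
    have hn2' : (2:ℝ) ≤ n := by exact_mod_cast hn2
    have hlog : 0 < Real.log n := Real.log_pos (by linarith)
    rw [div_lt_iff₀ hlog] at hn
    have h1 : c n ≤ (n:ℝ) ^ (1/2:ℝ) := by
      rw [Real.rpow_def_of_pos (by linarith), ← Real.log_le_iff_le_exp (hc n)]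
      linarith
    rw [div_le_iff₀ (by linarith)]
    have h2 : (n:ℝ) ^ (-(1/2:ℝ)) * n = (n:ℝ) ^ (1/2:ℝ) := by
      rw [← Real.rpow_add_one (by linarith)]; norm_num
    rw [h2]; exact h1
  have hS0 : Tendsto (fun n : ℕ => S (v n)) atTop (nhds 0) := by
    have h := hvS.mul hcn
    rw [mul_zero] at h
    refine h.congr' ?_
    filter_upwards [eventually_ge_atTop 1] with n hn
    have hn' : (0:ℝ) < n := by exact_mod_cast hn
    have := hc n
    field_simp
  have hvx1 : ∀ᶠ n in atTop, x1 ≤ v n := by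
    filter_upwards [hS0.eventually_lt_const (hSpos x1 hx1)] with n hn
    by_contra! h
    exact absurd (hSanti (v n) x1 (hvpos n) h.le) (not_le.2 hn)
  have hlim : Tendsto (fun n : ℕ => ((1 + K : ℕ) ^ M₀ : ℝ) * D * ((n : ℝ) * S (v n) / c n * (c n)⁻¹))
      atTop (nhds 0) := by
    have := (hvS.mul hctop.inv_tendsto_atTop).const_mul (((1 + K : ℕ) ^ M₀ : ℝ) * D)
    simpa using this
  refine squeeze_zero_norm' ?_ hlim
  filter_upwards [hvx1] with n hn
  have hvn := hvpos n
  have hcn := hc n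
  have hv2 : v n ^ (2 * p) = v n ^ p * v n ^ p := by rw [two_mul, Real.rpow_add hvn]
  set T := D * (v n ^ (2 * p) * S (v n)) with hT
  have hSv := hSpos _ hvn
  have hT0 : 0 ≤ T := by positivity
  have hcovT : ∀ i j : ℕ, |cov μ (fun ω => trunc (X i) (v n) ω ^ p)
      (fun ω => trunc (X j) (v n) ω ^ p)| ≤ T := by
    intro i j
    refine (aux_cov μ _ _ (hXmeas i) (hXnn i) (hXmeas j) (hXnn j) (v n) p hvn hp0).trans ?_
    calc v n ^ p * ∫ ω, trunc (X j) (v n) ω ^ p ∂μ ≤ v n ^ p * (D * (v n ^ p * S (v n))) := by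
          gcongr; exact hF j _ hn
      _ = T := by rw [hT, hv2]; ring
  have hrow : ∀ i : Fin n, |∑ j : Fin n, if i = j then 0
        else cov μ (fun ω => trunc (X (i : ℕ)) (v n) ω ^ p)
          (fun ω => trunc (X (j : ℕ)) (v n) ω ^ p)| ≤ ((1 + K : ℕ) ^ M₀ : ℝ) * T := by
    intro i
    obtain ⟨B, hB1, hB2⟩ := aux_ball (Fin n) (G n) K (hdeg n) M₀ i
    rw [← Finset.sum_subset (Finset.subset_univ B)]
    · refine (Finset.abs_sum_le_sum_abs _ _).trans ?_
      refine (Finset.sum_le_card_nsmul B _ T ?_).trans ?_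
      · intro j _
        split_ifs
        · simpa using hT0
        · exact hcovT i j
      · rw [nsmul_eq_mul]
        have : (B.card : ℝ) ≤ ((1 + K : ℕ) ^ M₀ : ℝ) := by exact_mod_cast hB1
        gcongr
    · intro j _ hj
      split_ifs
      · rfl
      · apply hcov0
        by_contra! h
        obtain ⟨w, hw⟩ := h.1.exists_walk_length_eq_dist
        exact hj (hB2 j w (by omega))
  rw [Real.norm_eq_abs, abs_div, abs_of_pos (show 0 < v n ^ (2*p) * c n ^ 2 by positivity),
    div_le_iff₀ (by positivity)]
  refine (Finset.abs_sum_le_sum_abs _ _).trans ?_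
  refine (Finset.sum_le_card_nsmul Finset.univ _ _ (fun i _ => hrow i)).trans (le_of_eq ?_)
  rw [nsmul_eq_mul, Finset.card_univ, Fintype.card_fin, hT]
  field_simp
end
end
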